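/- Let (A, [·,·], ∧) be a Gerstenhaber algebra, E the graded vector space with E_{−k} := A^k, 𝒩_k(P_1,…,P_k) := P_1∧⋯∧P_k, l_1 := 0, l_2(P_1,P_2) := (−1)^{|P_1|}[P_1,P_2], and l_i := ι_{l_2}𝒩_{i−1} for i > 2. Then for any n ≥ 1, l_n is an L∞-structure on E, and for all m, n ≥ 1, 𝒩_m is co-boundary Nijenhuis with respect to l_n and, up to a multiplicative constant, l_{n+m−1} is the deformed structure [𝒩_m, l_n]_RN of l_n by 𝒩_m. -/

import Mathlib

open Finset

section Framework

variable {V : Type*} [AddCommGroup V] [Module ℝ V]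

/-- The Koszul sign `ε(σ)` of a permutation `σ` acting on homogeneous elements whose
degrees are given by `d`. -/
def koszulSign {n : ℕ} (d : Fin n → ℤ) (σ : Equiv.Perm (Fin n)) : ℤ :=
  ∏ p ∈ Finset.univ.filter (fun p : Fin n × Fin n => p.1 < p.2 ∧ σ p.2 < σ p.1),
    (-1 : ℤ) ^ (d (σ p.1) * d (σ p.2)).natAbs

/-- The `(k, n-k)`-unshuffles: permutations of `Fin n` which are increasing on the
first `k` indices and on the remaining ones. -/
def unshuffles (k n : ℕ) : Finset (Equiv.Perm (Fin n)) :=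
  Finset.univ.filter (fun σ =>
    (∀ i j : Fin n, i < j → (j : ℕ) < k → σ i < σ j) ∧
    (∀ i j : Fin n, i < j → k ≤ (i : ℕ) → σ i < σ j))

/-- A (raw) vector valued `k`-form on the graded vector space with grading `𝒢`:
it assigns, to homogeneous elements of degrees `d 0, …, d (k-1)`, an element of `V`. -/
abbrev GForm (𝒢 : ℤ → Submodule ℝ V) (k : ℕ) : Type _ :=
  (d : Fin k → ℤ) → ((i : Fin k) → 𝒢 (d i)) → V

/-- Transport of a vector valued form along an equality of arities. -/
def castForm {𝒢 : ℤ → Submodule ℝ V} {m n : ℕ} (h : m = n) (K : GForm 𝒢 m) : GForm 𝒢 n :=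
  h ▸ K

variable (𝒢 : ℤ → Submodule ℝ V)

/-- Projection on the homogeneous component of degree `i`. -/
def prj [DirectSum.Decomposition 𝒢] (i : ℤ) (v : V) : 𝒢 i :=
  DirectSum.decompose 𝒢 v i

/-- Insertion of a `k`-form `K` of degree `δK` into an `(l+1)`-form `L`:
`ι_K L (X_1,…,X_{k+l}) = Σ_{σ ∈ Sh(k,l)} ε(σ) L(K(X_{σ(1)},…,X_{σ(k)}), X_{σ(k+1)},…)`. -/
def insertPos [DirectSum.Decomposition 𝒢] {k l : ℕ} (δK : ℤ) (K : GForm 𝒢 k)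
    (L : GForm 𝒢 (l + 1)) : GForm 𝒢 (k + l) := fun d x =>
  ∑ σ ∈ unshuffles k (k + l),
    koszulSign d σ •
      L (Fin.cons ((∑ i : Fin k, d (σ (Fin.castAdd l i))) + δK)
          (fun j : Fin l => d (σ (Fin.natAdd k j))))
        (Fin.cons
          (prj 𝒢 ((∑ i : Fin k, d (σ (Fin.castAdd l i))) + δK)
            (K (fun i => d (σ (Fin.castAdd l i))) (fun i => x (σ (Fin.castAdd l i)))))
          (fun j : Fin l => x (σ (Fin.natAdd k j))))

/-- Insertion operator `ι_K L` of a `k`-form of degree `δK` into an `l`-form. -/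
def insertionOp [DirectSum.Decomposition 𝒢] {k l : ℕ} (δK : ℤ) (K : GForm 𝒢 k) :
    GForm 𝒢 l → GForm 𝒢 (k + l - 1) :=
  match l with
  | 0 => fun _ => fun _ _ => 0
  | _ + 1 => fun L => insertPos 𝒢 δK K L

/-- A formal sum of vector valued forms of all arities. -/
abbrev MultiForm : Type _ := (k : ℕ) → GForm 𝒢 k

/-- A single `k`-form seen as a formal sum concentrated in arity `k`. -/
def singleF (k : ℕ) (K : GForm 𝒢 k) : MultiForm 𝒢 :=
  fun n => if h : n = k then castForm h.symm K else 0

/-- The Richardson–Nijenhuis bracket `[K,L] = ι_K L - (-1)^{K̄ L̄} ι_L K` of formal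
sums of forms `K` (of degree `δK`) and `L` (of degree `δL`), computed aritywise. -/
def rnBracketM [DirectSum.Decomposition 𝒢] (δK δL : ℤ) (K L : MultiForm 𝒢) : MultiForm 𝒢 :=
  fun n =>
    (∑ p ∈ (Finset.range (n + 2)).attach,
      castForm (by have := Finset.mem_range.mp p.2; omega)
        (insertionOp 𝒢 δK (K p.1) (L (n + 1 - p.1))))
    - ((-1 : ℤ) ^ (δK * δL).natAbs) •
      (∑ p ∈ (Finset.range (n + 2)).attach,
        castForm (by have := Finset.mem_range.mp p.2; omega)
          (insertionOp 𝒢 δL (L p.1) (K (n + 1 - p.1))))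

/-- `K` is a graded symmetric vector valued `k`-form of degree `δ`. -/
structure IsSymFormOfDeg {k : ℕ} (δ : ℤ) (K : GForm 𝒢 k) : Prop where
  mem_grading : ∀ (d : Fin k → ℤ) (x : (i : Fin k) → 𝒢 (d i)), K d x ∈ 𝒢 ((∑ i, d i) + δ)
  map_add : ∀ (d : Fin k → ℤ) (x : (i : Fin k) → 𝒢 (d i)) (i : Fin k) (a b : 𝒢 (d i)),
    K d (Function.update x i (a + b)) = K d (Function.update x i a) + K d (Function.update x i b)
  map_smul : ∀ (d : Fin k → ℤ) (x : (i : Fin k) → 𝒢 (d i)) (i : Fin k) (c : ℝ) (a : 𝒢 (d i)),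
    K d (Function.update x i (c • a)) = c • K d (Function.update x i a)
  symm : ∀ (d : Fin k → ℤ) (σ : Equiv.Perm (Fin k)) (x : (i : Fin k) → 𝒢 (d i)),
    K (d ∘ σ) (fun i => x (σ i)) = koszulSign d σ • K d x

/-- The `L_∞` identities for a family `(l_i)` of symmetric vector valued forms of degree 1:
for each `n`, `Σ_{i+j=n+1} Σ_{σ ∈ Sh(i,j-1)} ε(σ) l_j (l_i (X_σ(1),…), X_…) = 0`. -/
def LInftyIdentity [DirectSum.Decomposition 𝒢] (l : MultiForm 𝒢) : Prop :=
  ∀ n : ℕ,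
    (∑ p ∈ (Finset.range (n + 2)).attach,
      castForm (by have := Finset.mem_range.mp p.2; omega)
        (insertionOp 𝒢 1 (l p.1) (l (n + 1 - p.1)))) = (0 : GForm 𝒢 n)

end Framework

section Gerstenhaber

variable {V : Type*} [AddCommGroup V] [Module ℝ V]

/-- A Gerstenhaber algebra structure on a graded vector space `(V, 𝒜)`: a graded
commutative associative product `wedge` together with a graded Lie bracket on the
shifted space which is a degree `i` derivation in each argument. -/
structure Gerstenhaber (𝒜 : ℤ → Submodule ℝ V) : Type _ where
  wedge : V →ₗ[ℝ] V →ₗ[ℝ] V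
  bracket : V →ₗ[ℝ] V →ₗ[ℝ] V
  wedge_mem : ∀ (i j : ℤ) (x y : V), x ∈ 𝒜 i → y ∈ 𝒜 j → wedge x y ∈ 𝒜 (i + j)
  bracket_mem : ∀ (i j : ℤ) (x y : V), x ∈ 𝒜 i → y ∈ 𝒜 j → bracket x y ∈ 𝒜 (i + j - 1)
  wedge_assoc : ∀ x y z, wedge (wedge x y) z = wedge x (wedge y z)
  wedge_comm : ∀ (i j : ℤ) (x y : V), x ∈ 𝒜 i → y ∈ 𝒜 j →
    wedge x y = ((-1 : ℤ) ^ (i * j).natAbs) • wedge y x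
  bracket_antisymm : ∀ (i j : ℤ) (x y : V), x ∈ 𝒜 i → y ∈ 𝒜 j →
    bracket x y = -(((-1 : ℤ) ^ ((i - 1) * (j - 1)).natAbs) • bracket y x)
  jacobi : ∀ (i j : ℤ) (x y z : V), x ∈ 𝒜 i → y ∈ 𝒜 j →
    bracket x (bracket y z) = bracket (bracket x y) z
      + ((-1 : ℤ) ^ ((i - 1) * (j - 1)).natAbs) • bracket y (bracket x z)
  leibniz : ∀ (i j : ℤ) (x y z : V), x ∈ 𝒜 i → y ∈ 𝒜 j →
    bracket x (wedge y z) = wedge (bracket x y) z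
      + ((-1 : ℤ) ^ ((i - 1) * j).natAbs) • wedge y (bracket x z)

variable {𝒜 : ℤ → Submodule ℝ V}

/-- The grading of the graded vector space `E` with `E_{-k} := A^k`. -/
abbrev negG (𝒜 : ℤ → Submodule ℝ V) : ℤ → Submodule ℝ V := fun i => 𝒜 (-i)

/-- Iterated wedge product of `k+1` elements. -/
def wedgeAll (G : Gerstenhaber 𝒜) : {k : ℕ} → (Fin (k + 1) → V) → V
  | 0, x => x 0
  | _ + 1, x => G.wedge (x 0) (wedgeAll G (fun i => x i.succ))

/-- The symmetric vector valued `k`-form `𝒩_k (P_1, …, P_k) := P_1 ∧ ⋯ ∧ P_k`. -/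
def mathcalN (G : Gerstenhaber 𝒜) (𝒢 : ℤ → Submodule ℝ V) : (k : ℕ) → GForm 𝒢 k
  | 0 => fun _ _ => 0
  | _ + 1 => fun _ x => wedgeAll G (fun i => (x i : V))

/-- The symmetric vector valued 2-form `l_2 (P_1, P_2) := (-1)^{|P_1|} [P_1, P_2]`. -/
def l2G (G : Gerstenhaber 𝒜) (𝒢 : ℤ → Submodule ℝ V) : GForm 𝒢 2 :=
  fun d x => ((-1 : ℤ) ^ (d 0).natAbs) • G.bracket (x 0) (x 1)

/-- The family `l_1 := 0`, `l_2`, and `l_i := ι_{l_2} 𝒩_{i-1}` for `i > 2`. -/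
def lFormsG (G : Gerstenhaber 𝒜) (𝒢 : ℤ → Submodule ℝ V) [DirectSum.Decomposition 𝒢] :
    (i : ℕ) → GForm 𝒢 i
  | 0 => 0
  | 1 => 0
  | 2 => l2G G 𝒢
  | i + 3 => castForm (by omega) (insertionOp 𝒢 1 (l2G G 𝒢) (mathcalN G 𝒢 (i + 2)))

end Gerstenhaber
/-! ### Signs -/

/-- The sign `(-1)^i`. -/
def degSign (i : ℤ) : ℤ := (-1) ^ i.natAbs

lemma degSign_eq_ite (i : ℤ) : degSign i = if Even i then 1 else -1 := by
  unfold degSign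
  split_ifs with h
  · exact (Int.natAbs_even.mpr h).neg_one_pow
  · exact (Int.natAbs_odd.mpr (Int.not_even_iff_odd.mp h)).neg_one_pow

lemma degSign_congr {i j : ℤ} (h : Even i ↔ Even j) : degSign i = degSign j := by
  simp only [degSign_eq_ite, h]

lemma degSign_add (i j : ℤ) : degSign (i + j) = degSign i * degSign j := by
  simp only [degSign_eq_ite, Int.even_add]
  split_ifs <;> simp_all

@[simp] lemma degSign_zero : degSign 0 = 1 := rfl

@[simp] lemma degSign_one : degSign 1 = -1 := rfl

lemma degSign_mul_self (i : ℤ) : degSign i * degSign i = 1 := by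
  rw [degSign_eq_ite]; split_ifs <;> rfl

/-! ### Koszul signs -/

lemma koszulSign_eq_prod {n : ℕ} (d : Fin n → ℤ) (σ : Equiv.Perm (Fin n)) :
    koszulSign d σ =
      ∏ i, ∏ j, if i < j ∧ σ j < σ i then degSign (d (σ i) * d (σ j)) else 1 := by
  rw [← Fintype.prod_prod_type', koszulSign, Finset.prod_filter]
  rfl

/-- A product over unordered pairs can be reindexed by a permutation. -/
lemma prod_pairs_comp_perm {n : ℕ} (h : Fin n → Fin n → ℤ) (hs : ∀ i j, h i j = h j i)
    (τ : Equiv.Perm (Fin n)) :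
    ∏ p ∈ Finset.univ.filter (fun p : Fin n × Fin n => p.1 < p.2), h (τ p.1) (τ p.2) =
      ∏ p ∈ Finset.univ.filter (fun p : Fin n × Fin n => p.1 < p.2), h p.1 p.2 := by
  refine Finset.prod_nbij'
    (fun p => if τ p.1 < τ p.2 then (τ p.1, τ p.2) else (τ p.2, τ p.1))
    (fun p => if τ.symm p.1 < τ.symm p.2 then (τ.symm p.1, τ.symm p.2)
      else (τ.symm p.2, τ.symm p.1)) ?_ ?_ ?_ ?_ ?_
  · rintro ⟨i, j⟩ hij
    have hne : τ i ≠ τ j := fun e => by simp [τ.injective e] at hij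
    simp only [Finset.mem_filter, Finset.mem_univ, true_and] at hij ⊢
    split_ifs with h
    · exact h
    · exact lt_of_le_of_ne (not_lt.mp h) hne.symm
  · rintro ⟨i, j⟩ hij
    have hne : τ.symm i ≠ τ.symm j := fun e => by simp [τ.symm.injective e] at hij
    simp only [Finset.mem_filter, Finset.mem_univ, true_and] at hij ⊢
    split_ifs with h
    · exact h
    · exact lt_of_le_of_ne (not_lt.mp h) hne.symm
  · rintro ⟨i, j⟩ hij
    simp only [Finset.mem_filter, Finset.mem_univ, true_and] at hij ⊢
    by_cases h : τ i < τ j <;> simp [h, hij, hij.not_gt]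
  · rintro ⟨i, j⟩ hij
    simp only [Finset.mem_filter, Finset.mem_univ, true_and] at hij ⊢
    by_cases h : τ.symm i < τ.symm j <;> simp [h, hij, hij.not_gt]
  · rintro ⟨i, j⟩ hij
    dsimp only
    split_ifs
    · rfl
    · exact hs _ _

lemma koszulSign_mul {n : ℕ} (d : Fin n → ℤ) (σ τ : Equiv.Perm (Fin n)) :
    koszulSign d (σ * τ) = koszulSign d σ * koszulSign (d ∘ σ) τ := by
  set H : Fin n → Fin n → ℤ := fun a b =>
    if (a < b ∧ σ b < σ a) ∨ (b < a ∧ σ a < σ b) then degSign (d (σ a) * d (σ b)) else 1 with hH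
  have h1 : koszulSign d σ = ∏ p ∈ Finset.univ.filter (fun p : Fin n × Fin n => p.1 < p.2),
      H p.1 p.2 := by
    rw [koszulSign, ← Finset.filter_filter, Finset.prod_filter _ _ (s := Finset.filter _ _)]
    refine Finset.prod_congr rfl fun p hp => ?_
    have hp' : p.1 < p.2 := (Finset.mem_filter.mp hp).2
    simp only [hH, hp', hp'.not_gt, true_and, false_and, or_false]
    rfl
  have h2 : ∀ (e : Fin n → ℤ) (ρ : Equiv.Perm (Fin n)), koszulSign e ρ =
      ∏ p ∈ Finset.univ.filter (fun p : Fin n × Fin n => p.1 < p.2),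
        if ρ p.2 < ρ p.1 then degSign (e (ρ p.1) * e (ρ p.2)) else 1 := fun e ρ => by
    rw [koszulSign, ← Finset.filter_filter, Finset.prod_filter _ _ (s := Finset.filter _ _)]
    rfl
  rw [h1, ← prod_pairs_comp_perm H (fun i j => by simp only [hH, mul_comm (d (σ i)), or_comm]) τ,
    h2, h2, ← Finset.prod_mul_distrib]
  refine Finset.prod_congr rfl fun p hp => ?_
  have hp' : p.1 < p.2 := (Finset.mem_filter.mp hp).2
  have hne : τ p.1 ≠ τ p.2 := fun e => hp'.ne (τ.injective e)
  have hne' : σ (τ p.1) ≠ σ (τ p.2) := fun e => hne (σ.injective e)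
  have hsq := degSign_mul_self (d (σ (τ p.1)) * d (σ (τ p.2)))
  simp only [hH, Equiv.Perm.mul_apply, Function.comp]
  rcases lt_or_gt_of_ne hne with h2 | h2 <;> rcases lt_or_gt_of_ne hne' with h3 | h3 <;>
    simp [h2, h2.not_gt, h3, h3.not_gt, hsq]

lemma koszulSign_one {n : ℕ} (d : Fin n → ℤ) : koszulSign d 1 = 1 := by
  rw [koszulSign_eq_prod]
  refine Finset.prod_eq_one fun i _ => Finset.prod_eq_one fun j _ => if_neg fun h => ?_
  exact absurd h.1 h.2.not_gt

/-- Extension of a permutation of `Fin n` to `Fin (n + 1)` which sends `p` to `0` and is given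
by `τ` elsewhere. -/
def permInsert {n : ℕ} (p : Fin (n + 1)) (τ : Equiv.Perm (Fin n)) : Equiv.Perm (Fin (n + 1)) :=
  Equiv.Perm.decomposeFin.symm (0, τ) * p.cycleRange

@[simp] lemma permInsert_self {n : ℕ} (p : Fin (n + 1)) (τ : Equiv.Perm (Fin n)) :
    permInsert p τ p = 0 := by
  simp [permInsert]

@[simp] lemma permInsert_succAbove {n : ℕ} (p : Fin (n + 1)) (τ : Equiv.Perm (Fin n))
    (j : Fin n) : permInsert p τ (p.succAbove j) = (τ j).succ := by
  simp [permInsert]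

lemma permInsert_bijective {n : ℕ} :
    Function.Bijective (fun q : Fin (n + 1) × Equiv.Perm (Fin n) => permInsert q.1 q.2) := by
  rw [Fintype.bijective_iff_injective_and_card]
  constructor
  · rintro ⟨p, τ⟩ ⟨q, ρ⟩ h
    have hpq : p = q := by
      have h1 : permInsert q ρ p = 0 := by rw [← permInsert_self p τ]; exact (congrArg (· p) h).symm
      exact (permInsert q ρ).injective (h1.trans (permInsert_self q ρ).symm)
    subst hpq
    simp only [Prod.mk.injEq, true_and]
    ext j
    have := congrArg (fun f => f (p.succAbove j)) h
    simp only [permInsert_succAbove, Fin.succ_inj] at this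
    rw [this]
  · simp [Fintype.card_perm, Nat.factorial_succ]

lemma koszulSign_permInsert {n : ℕ} (d : Fin (n + 1) → ℤ) (p : Fin (n + 1))
    (τ : Equiv.Perm (Fin n)) :
    koszulSign d (permInsert p τ) = koszulSign (fun i => d i.succ) τ *
      degSign (d 0 * ∑ j : Fin n, if (j : ℕ) < p then d (τ j).succ else 0) := by
  rw [koszulSign_eq_prod, Fin.prod_univ_succAbove _ p]
  simp_rw [Fin.prod_univ_succAbove _ p]
  simp only [permInsert_self, permInsert_succAbove, lt_self_iff_false, if_false,
    Fin.not_lt_zero, and_false, Finset.prod_const_one, one_mul, Fin.succ_pos, and_true,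
    Fin.succ_lt_succ_iff, Fin.succAbove_lt_succAbove_iff, Finset.prod_mul_distrib]
  rw [mul_comm, koszulSign_eq_prod]
  congr 1
  have key : ∀ s : Finset (Fin n), degSign (d 0 * ∑ j ∈ s, if (j : ℕ) < p then d (τ j).succ else 0)
      = ∏ j ∈ s, if p.succAbove j < p then degSign (d (τ j).succ * d 0) else 1 := by
    intro s
    induction s using Finset.induction_on with
    | empty => simp
    | insert a s ha ih =>
      rw [Finset.sum_insert ha, Finset.prod_insert ha, mul_add, degSign_add, ih]
      congr 1
      have hlt : p.succAbove a < p ↔ (a : ℕ) < p := Fin.succAbove_lt_iff_castSucc_lt p a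
      simp only [hlt, mul_comm (d (τ a).succ)]
      split_ifs <;> simp
  exact (key _).symm

lemma koszulSign_swap {n : ℕ} (d : Fin (n + 1) → ℤ) (i : Fin n) :
    koszulSign d (Equiv.swap i.castSucc i.succ) = degSign (d i.castSucc * d i.succ) := by
  rw [koszulSign, Finset.prod_eq_single_of_mem (i.castSucc, i.succ)]
  · simp [degSign, mul_comm]
  · simp
  · rintro ⟨a, b⟩ hp hne
    exfalso
    rw [Finset.mem_filter] at hp
    obtain ⟨-, h1, h2⟩ := hp
    refine hne ?_
    simp only [Equiv.swap_apply_def, Fin.ext_iff, Prod.mk.injEq, Fin.lt_def, Fin.val_castSucc,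
      Fin.val_succ] at h1 h2 ⊢
    split_ifs at h2 <;> simp at h2 <;> omega

/-- Splitting the unshuffles of `n + 1` elements according to the position of the first one. -/
lemma permInsert_mem_unshuffles {n k : ℕ} (hk : k ≤ n + 1) (p : Fin (n + 1))
    (τ : Equiv.Perm (Fin n)) :
    permInsert p τ ∈ unshuffles k (n + 1) ↔
      (p = 0 ∧ 0 < k ∧ τ ∈ unshuffles (k - 1) n) ∨ ((p : ℕ) = k ∧ τ ∈ unshuffles k n) := by
  have hval : ∀ j : Fin n, ((p.succAbove j : Fin (n + 1)) : ℕ) = if (j : ℕ) < p then (j : ℕ) else j + 1 := by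
    intro j
    rw [Fin.succAbove]
    simp only [Fin.lt_def, Fin.val_castSucc]
    split_ifs <;> simp
  have hlt : ∀ i j : Fin n, permInsert p τ (p.succAbove i) < permInsert p τ (p.succAbove j) ↔
      τ i < τ j := by simp
  simp only [unshuffles, Finset.mem_filter, Finset.mem_univ, true_and]
  constructor
  · rintro ⟨h1, h2⟩
    have hp : p = 0 ∨ k ≤ p := by
      by_contra! h
      simpa using h1 0 p (Fin.pos_of_ne_zero h.1) h.2
    have hp' : (p : ℕ) ≤ k := by
      by_contra! h
      simpa using h2 ⟨k, by omega⟩ p h le_rfl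
    by_cases hpk : (p : ℕ) = k
    · refine Or.inr ⟨hpk, fun i j hij hj => ?_, fun i j hij hi => ?_⟩
      · refine (hlt i j).mp (h1 _ _ (by simpa using hij) ?_)
        rw [hval]; split_ifs <;> omega
      · refine (hlt i j).mp (h2 _ _ (by simpa using hij) ?_)
        rw [hval]; split_ifs <;> omega
    · have hp0 : p = 0 := by
        rcases hp with h | h
        · exact h
        · omega
      have hp0' : (p : ℕ) = 0 := by simp [hp0]
      refine Or.inl ⟨hp0, by omega, fun i j hij hj => ?_, fun i j hij hi => ?_⟩
      · refine (hlt i j).mp (h1 _ _ (by simpa using hij) ?_)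
        rw [hval]; split_ifs <;> omega
      · refine (hlt i j).mp (h2 _ _ (by simpa using hij) ?_)
        rw [hval]; split_ifs <;> omega
  · intro h
    constructor
    · intro i j hij hj
      rcases Fin.eq_self_or_eq_succAbove p i with hip | ⟨i, rfl⟩ <;>
        rcases Fin.eq_self_or_eq_succAbove p j with hjp | ⟨j, rfl⟩
      · exact absurd hij (by simp [hip, hjp])
      · simp [hip]
      · rw [hjp] at hij
        rw [Fin.lt_def, hval] at hij
        rcases h with ⟨rfl, -, -⟩ | ⟨h, -⟩
        · simp at hij
        · omega
      · rw [hlt]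
        have hij' : i < j := by simpa using hij
        rw [hval] at hj
        rcases h with ⟨rfl, -, h, -⟩ | ⟨hp, h, -⟩
        · exact h i j hij' (by simp at hj; omega)
        · exact h i j hij' (by split_ifs at hj <;> omega)
    · intro i j hij hi
      rcases Fin.eq_self_or_eq_succAbove p i with hip | ⟨i, rfl⟩ <;>
        rcases Fin.eq_self_or_eq_succAbove p j with hjp | ⟨j, rfl⟩
      · exact absurd hij (by simp [hip, hjp])
      · simp [hip]
      · rw [hjp] at hij
        rw [Fin.lt_def, hval] at hij
        rw [hval] at hi
        rcases h with ⟨rfl, -, -⟩ | ⟨h, -⟩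
        · simp at hij
        · split_ifs at hij hi <;> omega
      · rw [hlt]
        have hij' : i < j := by simpa using hij
        rw [hval] at hi
        rcases h with ⟨rfl, -, -, h⟩ | ⟨hp, -, h⟩
        · exact h i j hij' (by simp at hi; omega)
        · exact h i j hij' (by split_ifs at hi <;> omega)

lemma sum_unshuffles_succ {n k : ℕ} (hk : k ≤ n + 1) {M : Type*} [AddCommMonoid M]
    (f : Equiv.Perm (Fin (n + 1)) → M) :
    ∑ σ ∈ unshuffles k (n + 1), f σ =
      (if 0 < k then ∑ τ ∈ unshuffles (k - 1) n, f (permInsert 0 τ) else 0) +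
      (if h : k < n + 1 then ∑ τ ∈ unshuffles k n, f (permInsert ⟨k, h⟩ τ) else 0) := by
  have hfil : unshuffles k (n + 1) = Finset.univ.filter (· ∈ unshuffles k (n + 1)) := by simp
  have hsplit : ∀ (p : Fin (n + 1)) (τ : Equiv.Perm (Fin n)),
      (if permInsert p τ ∈ unshuffles k (n + 1) then f (permInsert p τ) else 0) =
      (if p = 0 then
        (if 0 < k ∧ τ ∈ unshuffles (k - 1) n then f (permInsert p τ) else 0) else 0) +
      (if (p : ℕ) = k then (if τ ∈ unshuffles k n then f (permInsert p τ) else 0) else 0) := by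
    intro p τ
    simp only [permInsert_mem_unshuffles hk]
    by_cases h0 : p = 0
    · subst h0
      rcases Nat.eq_zero_or_pos k with rfl | hk0
      · simp
      · simp [hk0, hk0.ne]
    · simp [h0, ite_and]
  rw [hfil, Finset.sum_filter,
    ← permInsert_bijective.sum_comp (fun σ => if σ ∈ unshuffles k (n + 1) then f σ else 0),
    Fintype.sum_prod_type]
  simp only [hsplit, Finset.sum_add_distrib]
  congr 1
  · rw [Finset.sum_eq_single 0 (by intro p _ hp; simp [hp]) (by simp)]
    by_cases h0 : 0 < k
    · simp [h0]
    · simp [h0]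
  · split_ifs with h
    · rw [Finset.sum_eq_single ⟨k, h⟩ (by intro p _ hp; simp [Fin.ext_iff] at hp; simp [hp])
        (by simp)]
      simp
    · refine Finset.sum_eq_zero fun p _ => ?_
      have : (p : ℕ) ≠ k := by omega
      simp [this]

/-! ### Shuffle sums over lists of homogeneous elements -/

section ShuffleSum

variable {V : Type*} [AddCommGroup V] [Module ℝ V] {𝒢 : ℤ → Submodule ℝ V}

/-- The total degree of a list of homogeneous elements. -/
def listDeg (z : List (Σ i, 𝒢 i)) : ℤ := (z.map Sigma.fst).sum

@[simp] lemma listDeg_nil : listDeg ([] : List (Σ i, 𝒢 i)) = 0 := rfl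

@[simp] lemma listDeg_cons (a : Σ i, 𝒢 i) (z : List (Σ i, 𝒢 i)) :
    listDeg (a :: z) = a.1 + listDeg z := by
  simp [listDeg]

@[simp] lemma listDeg_append (z w : List (Σ i, 𝒢 i)) :
    listDeg (z ++ w) = listDeg z + listDeg w := by
  simp [listDeg]

lemma List.Perm.listDeg_eq {z w : List (Σ i, 𝒢 i)} (h : z.Perm w) : listDeg z = listDeg w :=
  (h.map _).sum_eq

/-- The sum of `ε • Φ S R` over all the ways of unshuffling a list of homogeneous elements
into two sublists `S` and `R`, where `ε` is the Koszul sign. -/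
def shuffleSum : List (Σ i, 𝒢 i) → (List (Σ i, 𝒢 i) → List (Σ i, 𝒢 i) → V) → V
  | [], Φ => Φ [] []
  | a :: z, Φ => shuffleSum z
      (fun S R => Φ (a :: S) R + degSign (a.1 * listDeg S) • Φ S (a :: R))

variable (z : List (Σ i, 𝒢 i)) (Φ Ψ : List (Σ i, 𝒢 i) → List (Σ i, 𝒢 i) → V)

lemma shuffleSum_congr {Φ Ψ : List (Σ i, 𝒢 i) → List (Σ i, 𝒢 i) → V}
    {z : List (Σ i, 𝒢 i)} (h : ∀ S R, (S ++ R).Perm z → Φ S R = Ψ S R) :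
    shuffleSum z Φ = shuffleSum z Ψ := by
  induction z generalizing Φ Ψ with
  | nil => exact h _ _ (List.Perm.refl _)
  | cons a z ih =>
    refine ih fun S R hp => ?_
    rw [h _ _ (hp.cons a), h S (a :: R) (List.perm_middle.trans (hp.cons a))]

lemma shuffleSum_map (f : V →+ V) :
    shuffleSum z (fun S R => f (Φ S R)) = f (shuffleSum z Φ) := by
  induction z generalizing Φ with
  | nil => rfl
  | cons a z ih => simp only [shuffleSum, ← ih, map_add, map_zsmul]

lemma shuffleSum_add :
    shuffleSum z (fun S R => Φ S R + Ψ S R) = shuffleSum z Φ + shuffleSum z Ψ := by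
  induction z generalizing Φ Ψ with
  | nil => rfl
  | cons a z ih =>
    simp only [shuffleSum, ← ih]
    congr 1
    ext S R
    rw [smul_add]
    abel

lemma shuffleSum_zsmul (n : ℤ) :
    shuffleSum z (fun S R => n • Φ S R) = n • shuffleSum z Φ :=
  shuffleSum_map z Φ (DistribSMul.toAddMonoidHom V n)

lemma shuffleSum_smul (c : ℝ) :
    shuffleSum z (fun S R => c • Φ S R) = c • shuffleSum z Φ :=
  shuffleSum_map z Φ (DistribSMul.toAddMonoidHom V c)

lemma shuffleSum_linearMap (f : V →ₗ[ℝ] V) :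
    shuffleSum z (fun S R => f (Φ S R)) = f (shuffleSum z Φ) :=
  shuffleSum_map z Φ f.toAddMonoidHom

@[simp] lemma shuffleSum_zero : shuffleSum z (fun _ _ => 0) = 0 := by
  simpa using shuffleSum_smul z 0 0

lemma shuffleSum_mem {p : Submodule ℝ V} {Φ : List (Σ i, 𝒢 i) → List (Σ i, 𝒢 i) → V}
    {z : List (Σ i, 𝒢 i)} (h : ∀ S R, (S ++ R).Perm z → Φ S R ∈ p) : shuffleSum z Φ ∈ p := by
  induction z generalizing Φ with
  | nil => exact h _ _ (List.Perm.refl _)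
  | cons a z ih =>
    exact ih fun S R hp => p.add_mem (h _ _ (hp.cons a))
      (zsmul_mem (h _ _ (List.perm_middle.trans (hp.cons a))) _)

/-- Coassociativity of unshuffling. -/
lemma shuffleSum_assoc (Φ : List (Σ i, 𝒢 i) → List (Σ i, 𝒢 i) → List (Σ i, 𝒢 i) → V) :
    shuffleSum z (fun S R => shuffleSum S (fun P Q => Φ P Q R)) =
      shuffleSum z (fun P S => shuffleSum S (fun Q R => Φ P Q R)) := by
  induction z generalizing Φ with
  | nil => rfl
  | cons a z ih =>
    have e : ∀ S R, degSign (a.1 * listDeg S) • shuffleSum S (fun P Q => Φ P Q (a :: R)) =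
        shuffleSum S (fun P Q =>
          (degSign (a.1 * listDeg P) * degSign (a.1 * listDeg Q)) • Φ P Q (a :: R)) := by
      intro S R
      rw [← shuffleSum_zsmul]
      refine shuffleSum_congr fun P Q hp => ?_
      rw [← hp.listDeg_eq, listDeg_append, mul_add, degSign_add]
    simp only [shuffleSum, e, ← shuffleSum_add, ← shuffleSum_zsmul]
    rw [ih]
    congr 1
    ext P S
    congr 1
    ext Q R
    rw [smul_add, mul_smul]
    abel

/-- Cocommutativity of unshuffling. -/
lemma shuffleSum_comm :
    shuffleSum z Φ = shuffleSum z (fun S R => degSign (listDeg S * listDeg R) • Φ R S) := by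
  induction z generalizing Φ with
  | nil => simp [shuffleSum]
  | cons a z ih =>
    simp only [shuffleSum]
    rw [ih]
    congr 1
    ext S R
    rw [smul_add, smul_smul, smul_smul, add_comm, ← degSign_add, ← degSign_add]
    congr 2 <;> refine degSign_congr ?_ <;> simp only [listDeg_cons, Int.even_add, Int.even_mul] <;>
      tauto

/-- Compatibility of unshuffling with exchanging two adjacent elements. -/
lemma shuffleSum_swap (p q : List (Σ i, 𝒢 i)) (a b : Σ i, 𝒢 i)
    (h₁ : ∀ p q R, Φ (p ++ a :: b :: q) R = degSign (a.1 * b.1) • Φ (p ++ b :: a :: q) R)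
    (h₂ : ∀ p q S, Φ S (p ++ a :: b :: q) = degSign (a.1 * b.1) • Φ S (p ++ b :: a :: q)) :
    shuffleSum (p ++ a :: b :: q) Φ =
      degSign (a.1 * b.1) • shuffleSum (p ++ b :: a :: q) Φ := by
  induction p generalizing Φ with
  | nil =>
    simp only [List.nil_append, shuffleSum, ← shuffleSum_zsmul]
    congr 1
    ext S R
    have e₁ := h₁ [] S R
    have e₂ := h₂ [] R S
    simp only [List.nil_append] at e₁ e₂
    rw [e₁, e₂]
    have s₁ : degSign (a.1 * (b.1 + listDeg S)) = degSign (a.1 * b.1 + a.1 * listDeg S) := by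
      rw [mul_add]
    have s₂ : degSign (a.1 * b.1 + b.1 * (a.1 + listDeg S)) = degSign (b.1 * listDeg S) := by
      refine degSign_congr ?_
      simp only [Int.even_add, Int.even_mul]
      tauto
    have s₃ : degSign (b.1 * listDeg S + a.1 * listDeg S + a.1 * b.1) =
        degSign (a.1 * b.1 + (a.1 * listDeg S + b.1 * listDeg S)) := by
      ring_nf
    simp only [smul_add, smul_smul, ← degSign_add, listDeg_cons, ← add_assoc] at s₁ s₂ s₃ ⊢
    rw [s₁, s₂, s₃]
    abel
  | cons c p ih =>
    refine ih _ (fun p q R => ?_) (fun p q S => ?_)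
    · have := h₁ (c :: p) q R
      simp only [List.cons_append] at this
      rw [this, h₁, smul_add, smul_comm]
      congr 3
      simp [add_left_comm]
    · have := h₂ (c :: p) q S
      simp only [List.cons_append] at this
      rw [this, h₂, smul_add, smul_comm]

/-- Linearity of a function of lists of homogeneous elements in each element. -/
def ListLinear (F : List (Σ i, 𝒢 i) → V) : Prop :=
  ∀ (p q : List (Σ i, 𝒢 i)) (i : ℤ) (c : ℝ) (x y : 𝒢 i),
    F (p ++ ⟨i, c • x + y⟩ :: q) = c • F (p ++ ⟨i, x⟩ :: q) + F (p ++ ⟨i, y⟩ :: q)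

lemma ListLinear.shuffleSum {Φ : List (Σ i, 𝒢 i) → List (Σ i, 𝒢 i) → V}
    (h₁ : ∀ R, ListLinear (fun S => Φ S R)) (h₂ : ∀ S, ListLinear (Φ S)) :
    ListLinear (fun z => shuffleSum z Φ) := by
  intro p q i c x y
  induction p generalizing Φ with
  | nil =>
    simp only [List.nil_append, _root_.shuffleSum, ← shuffleSum_add, ← shuffleSum_smul]
    congr 1
    ext S R
    have e₁ := h₁ R [] S i c x y
    have e₂ := h₂ S [] R i c x y
    simp only [List.nil_append] at e₁ e₂
    rw [e₁, e₂, smul_add, smul_add, smul_comm c]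
    abel
  | cons b p ih =>
    refine ih (fun R p q i c x y => ?_) (fun S p q i c x y => ?_)
    · have e := h₁ R (b :: p) q i c x y
      have e' := h₁ (b :: R) p q i c x y
      simp only [List.cons_append] at e
      simp only [e, e', smul_add, listDeg_append, listDeg_cons, smul_comm c]
      abel
    · have e := h₂ S (b :: p) q i c x y
      simp only [List.cons_append] at e
      rw [e, h₂, smul_add, smul_add, smul_comm c]
      abel

lemma listDeg_take_ofFn {n : ℕ} (w : Fin n → Σ i, 𝒢 i) (k : ℕ) :
    listDeg ((List.ofFn w).take k) = ∑ i : Fin n, if (i : ℕ) < k then (w i).1 else 0 := by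
  induction n generalizing k with
  | zero => simp
  | succ n ih =>
    cases k with
    | zero => simp
    | succ k => simp [List.ofFn_succ, Fin.sum_univ_succ, ih]

lemma ofFn_eq_take_append_cons_drop {α : Type*} {n : ℕ} (p : Fin (n + 1)) (f : Fin (n + 1) → α) :
    List.ofFn f = (List.ofFn fun j => f (p.succAbove j)).take p ++
      f p :: (List.ofFn fun j => f (p.succAbove j)).drop p := by
  induction n with
  | zero =>
    obtain rfl := Fin.fin_one_eq_zero p
    simp
  | succ n ih =>
    refine Fin.cases ?_ (fun p => ?_) p
    · simp [List.ofFn_succ]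
    · rw [List.ofFn_succ, ih p]
      simp [List.ofFn_succ]

/-- Shuffle sums restricted to a given length of the first sublist are sums over
unshuffles. -/
lemma sum_unshuffles_eq_shuffleSum {n k : ℕ} (hk : k ≤ n) (z : Fin n → Σ i, 𝒢 i) :
    ∑ σ ∈ unshuffles k n, koszulSign (fun i => (z i).1) σ •
        Φ ((List.ofFn fun i => z (σ i)).take k) ((List.ofFn fun i => z (σ i)).drop k) =
      shuffleSum (List.ofFn z) (fun S R => if S.length = k then Φ S R else 0) := by
  induction n generalizing k Φ with
  | zero =>
    obtain rfl : k = 0 := by omega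
    simp [shuffleSum, unshuffles, koszulSign]
  | succ n ih =>
    rw [sum_unshuffles_succ hk]
    simp only [List.ofFn_succ (f := z), shuffleSum, List.length_cons, shuffleSum_add]
    congr 1
    · cases k with
      | zero => simp
      | succ k =>
        rw [if_pos k.succ_pos]
        simp only [Nat.add_right_cancel_iff]
        rw [← ih (fun S R => Φ (z 0 :: S) R) (Nat.le_of_succ_le_succ hk)]
        refine Finset.sum_congr rfl fun τ _ => ?_
        have hz : (List.ofFn fun i => z (permInsert 0 τ i)) =
            z 0 :: List.ofFn fun i => z (τ i).succ := by
          have := permInsert_succAbove 0 τ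
          simp only [Fin.succAbove_zero] at this
          simp [List.ofFn_succ, this]
        rw [hz, koszulSign_permInsert]
        simp
    · split_ifs with h
      · have hR := ih (fun S R => degSign ((z 0).1 * listDeg S) • Φ S (z 0 :: R))
          (Nat.le_of_lt_succ h) (fun i => z i.succ)
        simp only [smul_ite, smul_zero]
        rw [← hR]
        refine Finset.sum_congr rfl fun τ _ => ?_
        have hz := ofFn_eq_take_append_cons_drop ⟨k, h⟩ (fun i => z (permInsert ⟨k, h⟩ τ i))
        simp only [permInsert_self, permInsert_succAbove] at hz
        have hl : ((List.ofFn fun j => z (τ j).succ).take k).length = k := by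
          simp; omega
        rw [hz, List.take_left' hl, List.drop_left' hl, koszulSign_permInsert, smul_smul,
          listDeg_take_ofFn]
      · refine (shuffleSum_zero _).symm.trans (shuffleSum_congr fun S R hp => ?_)
        have := hp.length_eq
        rw [if_neg, smul_zero]
        simp at this
        omega

end ShuffleSum

/-! ### Vector valued forms defined by functions of lists -/

section ListForm

variable {V : Type*} [AddCommGroup V] [Module ℝ V] (𝒢 : ℤ → Submodule ℝ V)

/-- The formal sum of vector valued forms given by a function of lists of homogeneous
elements. -/
def listForm (F : List (Σ i, 𝒢 i) → V) : MultiForm 𝒢 :=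
  fun _ d x => F (List.ofFn fun i => ⟨d i, x i⟩)

variable {𝒢}

lemma ofFn_perm_of_symm {F : List (Σ i, 𝒢 i) → V}
    (hF : ∀ p q a b, F (p ++ a :: b :: q) = degSign (a.1 * b.1) • F (p ++ b :: a :: q))
    {n : ℕ} (z : Fin n → Σ i, 𝒢 i) (σ : Equiv.Perm (Fin n)) :
    F (List.ofFn fun i => z (σ i)) = koszulSign (fun i => (z i).1) σ • F (List.ofFn z) := by
  cases n with
  | zero => simp [Subsingleton.elim σ 1, koszulSign_one]
  | succ n =>
    have hσ : σ ∈ Submonoid.closure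
        (Set.range fun i : Fin n => Equiv.swap i.castSucc i.succ) := by
      rw [Equiv.Perm.mclosure_swap_castSucc_succ]
      trivial
    induction hσ using Submonoid.closure_induction generalizing z with
    | one => simp [koszulSign_one]
    | mul σ τ _ _ ihσ ihτ =>
      rw [koszulSign_mul, mul_comm, mul_smul, ← ihσ z]
      exact ihτ fun i => z (σ i)
    | mem σ hσ =>
      obtain ⟨i, rfl⟩ := hσ
      dsimp only
      rw [koszulSign_swap]
      have hsplit : ∀ w : Fin (n + 1) → Σ i, 𝒢 i, List.ofFn w =
          (List.ofFn w).take i ++ w i.castSucc :: w i.succ :: (List.ofFn w).drop (i + 2) := by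
        intro w
        conv_lhs => rw [← List.take_append_drop i (List.ofFn w)]
        congr 1
        rw [List.drop_eq_getElem_cons (by simp), List.drop_eq_getElem_cons (by simp)]
        simp only [List.getElem_ofFn]
        rfl
      rw [hsplit, hsplit z, Equiv.swap_apply_left, Equiv.swap_apply_right, hF, mul_comm]
      congr 3
      · refine List.ext_getElem (by simp) fun j h₁ h₂ => ?_
        simp only [List.length_take, List.length_ofFn] at h₁
        simp only [List.getElem_take, List.getElem_ofFn]
        rw [Equiv.swap_apply_of_ne_of_ne] <;> simp [Fin.ext_iff] <;> omega
      · congr 2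
        refine List.ext_getElem (by simp) fun j h₁ h₂ => ?_
        simp only [List.getElem_drop, List.getElem_ofFn]
        rw [Equiv.swap_apply_of_ne_of_ne] <;> simp [Fin.ext_iff] <;> omega

lemma ListLinear.map_zero {F : List (Σ i, 𝒢 i) → V} (hF : ListLinear F)
    (p q : List (Σ i, 𝒢 i)) (i : ℤ) : F (p ++ ⟨i, 0⟩ :: q) = 0 := by
  simpa using hF p q i 1 0 0

lemma ListLinear.map_smul {F : List (Σ i, 𝒢 i) → V} (hF : ListLinear F)
    (p q : List (Σ i, 𝒢 i)) (i : ℤ) (c : ℝ) (x : 𝒢 i) :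
    F (p ++ ⟨i, c • x⟩ :: q) = c • F (p ++ ⟨i, x⟩ :: q) := by
  simpa [hF.map_zero] using hF p q i c x 0

lemma isSymFormOfDeg_listForm {F : List (Σ i, 𝒢 i) → V} {δ : ℤ}
    (hdeg : ∀ z, F z ∈ 𝒢 (listDeg z + δ)) (hlin : ListLinear F)
    (hsymm : ∀ p q a b, F (p ++ a :: b :: q) = degSign (a.1 * b.1) • F (p ++ b :: a :: q))
    (n : ℕ) : IsSymFormOfDeg 𝒢 δ (listForm 𝒢 F n) := by
  have hsplit : ∀ (d : Fin n → ℤ) (x : (i : Fin n) → 𝒢 (d i)) (i : Fin n) (a : 𝒢 (d i)),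
      (List.ofFn fun j => (⟨d j, Function.update x i a j⟩ : Σ i, 𝒢 i)) =
        (List.ofFn fun j => (⟨d j, x j⟩ : Σ i, 𝒢 i)).take i ++ ⟨d i, a⟩ ::
          (List.ofFn fun j => (⟨d j, x j⟩ : Σ i, 𝒢 i)).drop (i + 1) := by
    intro d x i a
    conv_lhs => rw [← List.take_append_drop i (List.ofFn _)]
    rw [List.drop_eq_getElem_cons (by simp)]
    congr 1
    · refine List.ext_getElem (by simp) fun j h₁ h₂ => ?_
      simp only [List.length_take, List.length_ofFn] at h₁
      simp only [List.getElem_take, List.getElem_ofFn]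
      rw [Function.update_of_ne]
      simp [Fin.ext_iff]; omega
    · congr 1
      · simp
      · refine List.ext_getElem (by simp) fun j h₁ h₂ => ?_
        simp only [List.getElem_drop, List.getElem_ofFn]
        rw [Function.update_of_ne]
        simp [Fin.ext_iff]; omega
  refine ⟨fun d x => ?_, fun d x i a b => ?_, fun d x i c a => ?_, fun d σ x => ?_⟩
  · have := hdeg (List.ofFn fun i => ⟨d i, x i⟩)
    rwa [listDeg, List.map_ofFn, List.sum_ofFn] at this
  · simpa only [listForm, hsplit, one_smul] using hlin _ _ (d i) 1 a b
  · simpa only [listForm, hsplit] using hlin.map_smul _ _ (d i) c a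
  · exact ofFn_perm_of_symm hsymm (fun i => ⟨d i, x i⟩) σ

lemma sigma_prj_congr [DirectSum.Decomposition 𝒢] {i j : ℤ} {v w : V} (hi : i = j) (hv : v = w) :
    (⟨i, prj 𝒢 i v⟩ : Σ i, 𝒢 i) = ⟨j, prj 𝒢 j w⟩ := by
  subst hi hv; rfl

/-- The insertion of `K` (of degree `δ`) into `L` for functions of lists. -/
def listInsert [DirectSum.Decomposition 𝒢] (δ : ℤ) (K L : List (Σ i, 𝒢 i) → V)
    (z : List (Σ i, 𝒢 i)) : V :=
  shuffleSum z fun S R => L (⟨listDeg S + δ, prj 𝒢 (listDeg S + δ) (K S)⟩ :: R)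

lemma castForm_insertionOp_listForm [DirectSum.Decomposition 𝒢] (δ : ℤ)
    (K L : List (Σ i, 𝒢 i) → V) {k l n : ℕ} (h : k + (l + 1) - 1 = n) (d : Fin n → ℤ)
    (x : (i : Fin n) → 𝒢 (d i)) :
    castForm h (insertionOp 𝒢 δ (listForm 𝒢 K k) (listForm 𝒢 L (l + 1))) d x =
      shuffleSum (List.ofFn fun i => ⟨d i, x i⟩) fun S R => if S.length = k then
        L (⟨listDeg S + δ, prj 𝒢 (listDeg S + δ) (K S)⟩ :: R) else 0 := by
  obtain rfl : k + l = n := h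
  rw [← sum_unshuffles_eq_shuffleSum
    (fun S R => L (⟨listDeg S + δ, prj 𝒢 (listDeg S + δ) (K S)⟩ :: R)) (Nat.le_add_right k l)]
  change insertPos 𝒢 δ (listForm 𝒢 K k) (listForm 𝒢 L (l + 1)) d x = _
  refine Finset.sum_congr rfl fun σ _ => ?_
  have hT : (List.ofFn fun i => (⟨d (σ i), x (σ i)⟩ : Σ i, 𝒢 i)).take k =
      List.ofFn fun i : Fin k => ⟨d (σ (Fin.castAdd l i)), x (σ (Fin.castAdd l i))⟩ := by
    rw [List.ofFn_add]
    exact List.take_left' (by simp)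
  have hD : (List.ofFn fun i => (⟨d (σ i), x (σ i)⟩ : Σ i, 𝒢 i)).drop k =
      List.ofFn fun j : Fin l => ⟨d (σ (Fin.natAdd k j)), x (σ (Fin.natAdd k j))⟩ := by
    rw [List.ofFn_add]
    exact List.drop_left' (by simp)
  dsimp only
  rw [hT, hD]
  simp only [listForm, List.ofFn_succ]
  congr 2
  refine congrArg (· :: _) (sigma_prj_congr ?_ rfl)
  simp [listDeg, List.sum_ofFn]

lemma rnBracketM_listForm [DirectSum.Decomposition 𝒢] (δK δL : ℤ)
    (K L : List (Σ i, 𝒢 i) → V) :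
    rnBracketM 𝒢 δK δL (listForm 𝒢 K) (listForm 𝒢 L) = listForm 𝒢 (fun z =>
      listInsert δK K L z - degSign (δK * δL) • listInsert δL L K z) := by
  have key : ∀ (δ : ℤ) (K L : List (Σ i, 𝒢 i) → V) (n : ℕ)
      (h : ∀ p : {p // p ∈ Finset.range (n + 2)}, p.1 + (n + 1 - p.1) - 1 = n)
      (d : Fin n → ℤ) (x : (i : Fin n) → 𝒢 (d i)),
      (∑ p ∈ (Finset.range (n + 2)).attach, castForm (h p)
        (insertionOp 𝒢 δ (listForm 𝒢 K p.1) (listForm 𝒢 L (n + 1 - p.1)))) d x =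
      listInsert δ K L (List.ofFn fun i => ⟨d i, x i⟩) := by
    intro δ K L n h d x
    have hterm : ∀ p : {p // p ∈ Finset.range (n + 2)}, castForm (h p)
        (insertionOp 𝒢 δ (listForm 𝒢 K p.1) (listForm 𝒢 L (n + 1 - p.1))) d x =
        shuffleSum (List.ofFn fun i => ⟨d i, x i⟩) fun S R => if S.length = p.1 then
          L (⟨listDeg S + δ, prj 𝒢 (listDeg S + δ) (K S)⟩ :: R) else 0 := by
      rintro ⟨p, hp⟩
      have hp' := Finset.mem_range.mp hp
      generalize h ⟨p, hp⟩ = hpn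
      dsimp only at hpn ⊢
      obtain hpn' | hpn' := Nat.lt_succ_iff_lt_or_eq.mp hp'
      · obtain ⟨l, hl⟩ : ∃ l, n + 1 - p = l + 1 := ⟨n - p, by omega⟩
        revert hpn
        rw [hl]
        intro hpn
        exact castForm_insertionOp_listForm δ K L hpn d x
      · have hl : n + 1 - p = 0 := by omega
        revert hpn
        rw [hl]
        intro hpn
        have hz : ∀ {m : ℕ} (e : m = n), castForm (𝒢 := 𝒢) e (fun _ _ => 0) d x = 0 := by
          rintro _ rfl; rfl
        refine (hz hpn).trans ((shuffleSum_zero _).symm.trans (shuffleSum_congr fun S R hSR => ?_))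
        have := hSR.length_eq
        simp at this
        rw [if_neg]
        omega
    rw [Finset.sum_apply, Finset.sum_apply, Finset.sum_congr rfl fun p _ => hterm p,
      Finset.sum_attach (Finset.range (n + 2)) (fun p => shuffleSum _ fun S R =>
        if S.length = p then L (⟨listDeg S + δ, prj 𝒢 (listDeg S + δ) (K S)⟩ :: R) else 0)]
    have hsum : ∀ (s : Finset ℕ) (z : List (Σ i, 𝒢 i))
        (Φ : ℕ → List (Σ i, 𝒢 i) → List (Σ i, 𝒢 i) → V),
        ∑ p ∈ s, shuffleSum z (Φ p) = shuffleSum z fun S R => ∑ p ∈ s, Φ p S R := by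
      intro s z Φ
      induction s using Finset.induction_on with
      | empty => simp
      | insert a s ha ih => simp only [Finset.sum_insert ha, ih, shuffleSum_add]
    rw [hsum]
    refine shuffleSum_congr fun S R hSR => ?_
    have := hSR.length_eq
    simp at this
    rw [Finset.sum_ite_eq, if_pos]
    rw [Finset.mem_range]
    omega
  ext n d x
  simp only [rnBracketM, Pi.sub_apply, Pi.smul_apply, key]
  rfl

end ListForm

/-! ### Convolution of functions of lists -/

section Convolution

variable {V : Type*} [AddCommGroup V] [Module ℝ V] {𝒢 : ℤ → Submodule ℝ V}

/-- The convolution product, with respect to unshuffling and to the bilinear map `B`, of two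
functions of lists; `δ` is the degree by which the elements of the first list are twisted. -/
def conv (δ : ℤ) (B : V →ₗ[ℝ] V →ₗ[ℝ] V) (F G : List (Σ i, 𝒢 i) → V) (z : List (Σ i, 𝒢 i)) : V :=
  shuffleSum z fun S R => degSign (δ * listDeg S) • B (F S) (G R)

/-- The function of lists given by the identity on lists of length one. -/
def idForm : List (Σ i, 𝒢 i) → V
  | [a] => a.2
  | _ => 0

/-- Homogeneity of degree `α` of a function of lists. -/
def ListHom (α : ℤ) (F : List (Σ i, 𝒢 i) → V) : Prop := ∀ z, F z ∈ 𝒢 (listDeg z + α)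

/-- Graded symmetry of a function of lists. -/
def ListSymm (F : List (Σ i, 𝒢 i) → V) : Prop :=
  ∀ p q a b, F (p ++ a :: b :: q) = degSign (a.1 * b.1) • F (p ++ b :: a :: q)

/-- A function of lists vanishing outside the lists of length `k`. -/
def ListArity (k : ℕ) (F : List (Σ i, 𝒢 i) → V) : Prop := ∀ z, z.length ≠ k → F z = 0

variable {B : V →ₗ[ℝ] V →ₗ[ℝ] V} {δ δ' : ℤ} {F F' G H : List (Σ i, 𝒢 i) → V}

lemma conv_add_left : conv δ B (F + F') G = conv δ B F G + conv δ B F' G := by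
  ext z
  simp only [conv, Pi.add_apply, map_add, LinearMap.add_apply, smul_add, shuffleSum_add]

lemma conv_smul_left (c : ℝ) : conv δ B (c • F) G = c • conv δ B F G := by
  ext z
  simp only [conv, Pi.smul_apply, map_smul, LinearMap.smul_apply, smul_comm _ c, shuffleSum_smul]

lemma conv_congr (h : Even δ ↔ Even δ') : conv δ B F G = conv δ' B F G := by
  ext z
  refine shuffleSum_congr fun S R _ => ?_
  rw [degSign_congr (i := δ * listDeg S) (j := δ' * listDeg S)]
  simp only [Int.even_mul, h]

lemma conv_conv_right (B' : V →ₗ[ℝ] V →ₗ[ℝ] V) (z : List (Σ i, 𝒢 i)) :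
    conv δ B F (conv δ' B' G H) z = shuffleSum z fun P S => shuffleSum S fun Q R =>
      degSign (δ * listDeg P + δ' * listDeg Q) • B (F P) (B' (G Q) (H R)) := by
  refine shuffleSum_congr fun P S _ => ?_
  rw [conv, ← shuffleSum_linearMap S _ (B (F P)), ← shuffleSum_zsmul]
  simp only [map_zsmul, smul_smul, ← degSign_add]

lemma conv_conv_left (B' : V →ₗ[ℝ] V →ₗ[ℝ] V) (z : List (Σ i, 𝒢 i)) :
    conv δ B (conv δ' B' F G) H z = shuffleSum z fun P S => shuffleSum S fun Q R =>
      degSign (δ * listDeg P + δ * listDeg Q + δ' * listDeg P) • B (B' (F P) (G Q)) (H R) := by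
  rw [← shuffleSum_assoc z fun P Q R =>
    degSign (δ * listDeg P + δ * listDeg Q + δ' * listDeg P) • B (B' (F P) (G Q)) (H R)]
  refine shuffleSum_congr fun S R _ => ?_
  rw [conv, ← LinearMap.flip_apply, ← shuffleSum_linearMap S _ (B.flip (H R)),
    ← shuffleSum_zsmul]
  refine shuffleSum_congr fun P Q hS => ?_
  simp only [map_zsmul, smul_smul, ← degSign_add,
    ← hS.listDeg_eq, listDeg_append, mul_add, LinearMap.flip_apply]

lemma conv_assoc (hB : ∀ x y z, B (B x y) z = B x (B y z)) :
    conv δ B F (conv 0 B G H) = conv 0 B (conv δ B F G) H := by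
  ext z
  simp only [conv_conv_left, conv_conv_right, zero_mul, zero_add, add_zero, hB]

/-- Exchange of the first two sublists in a sum over unshuffles into three sublists. -/
lemma shuffleSum_comm₁₂ (z : List (Σ i, 𝒢 i))
    (Φ : List (Σ i, 𝒢 i) → List (Σ i, 𝒢 i) → List (Σ i, 𝒢 i) → V) :
    (shuffleSum z fun P S => shuffleSum S fun Q R => Φ P Q R) =
      shuffleSum z fun P S => shuffleSum S fun Q R =>
        degSign (listDeg P * listDeg Q) • Φ Q P R := by
  rw [← shuffleSum_assoc, ← shuffleSum_assoc z fun P Q R =>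
    degSign (listDeg P * listDeg Q) • Φ Q P R]
  exact shuffleSum_congr fun S R _ => shuffleSum_comm S fun P Q => Φ P Q R

lemma ListHom.conv {α β γ : ℤ} (hF : ListHom α F) (hG : ListHom β G)
    (hB : ∀ (i j : ℤ) (x y : V), x ∈ 𝒢 i → y ∈ 𝒢 j → B x y ∈ 𝒢 (i + j + γ)) :
    ListHom (α + β + γ) (conv δ B F G) := by
  refine fun z => shuffleSum_mem fun S R hp => zsmul_mem ?_ _
  have := hB _ _ _ _ (hF S) (hG R)
  rwa [← hp.listDeg_eq, listDeg_append, show listDeg S + listDeg R + (α + β + γ) =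
    listDeg S + α + (listDeg R + β) + γ by ring]

lemma ListSymm.conv (hF : ListSymm F) (hG : ListSymm G) : ListSymm (conv δ B F G) := by
  refine fun p q a b => shuffleSum_swap _ p q a b (fun p q R => ?_) (fun p q S => ?_)
  · rw [hF, map_zsmul, LinearMap.smul_apply, smul_comm]
    congr 3
    simp [add_left_comm]
  · rw [hG, map_zsmul, smul_comm]

lemma ListLinear.conv (hF : ListLinear F) (hG : ListLinear G) : ListLinear (conv δ B F G) := by
  refine ListLinear.shuffleSum (fun R p q i c x y => ?_) (fun S p q i c x y => ?_)
  · simp only [hF p q i c x y, map_add, _root_.map_smul, LinearMap.add_apply,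
      LinearMap.smul_apply, smul_add, listDeg_append, listDeg_cons, smul_comm c]
  · simp only [hG p q i c x y, map_add, _root_.map_smul, smul_add, smul_comm c]

lemma ListArity.conv {k l : ℕ} (hF : ListArity k F) (hG : ListArity l G) :
    ListArity (k + l) (conv δ B F G) := by
  refine fun z hz => (shuffleSum_congr fun S R hp => ?_).trans (shuffleSum_zero z)
  have hl := hp.length_eq
  rw [List.length_append] at hl
  by_cases hS : S.length = k
  · rw [hG R (by omega), map_zero, smul_zero]
  · rw [hF S hS, map_zero, LinearMap.zero_apply, smul_zero]

lemma ListHom.smul {α : ℤ} (hF : ListHom α F) (c : ℝ) : ListHom α (c • F) :=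
  fun z => Submodule.smul_mem _ c (hF z)

lemma ListSymm.smul (hF : ListSymm F) (c : ℝ) : ListSymm (c • F) := fun p q a b => by
  simp only [Pi.smul_apply, hF p q a b, smul_comm c]

lemma ListLinear.smul (hF : ListLinear F) (c : ℝ) : ListLinear (c • F) := fun p q i t x y => by
  simp only [Pi.smul_apply, hF p q i t x y, smul_add, smul_comm c]

lemma ListArity.smul {k : ℕ} (hF : ListArity k F) (c : ℝ) : ListArity k (c • F) :=
  fun z hz => by rw [Pi.smul_apply, hF z hz, smul_zero]

lemma idForm_hom : ListHom 0 (idForm (𝒢 := 𝒢)) := by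
  rintro (_ | ⟨a, _ | ⟨b, z⟩⟩)
  · exact zero_mem _
  · simp [idForm]
  · exact zero_mem _

lemma idForm_arity : ListArity 1 (idForm (𝒢 := 𝒢)) := by
  rintro (_ | ⟨a, _ | ⟨b, z⟩⟩) h <;> simp_all [idForm]

lemma idForm_symm : ListSymm (idForm (𝒢 := 𝒢)) := fun p q a b => by
  rw [idForm_arity _ (by simp; omega), idForm_arity _ (by simp; omega), smul_zero]

lemma idForm_linear : ListLinear (idForm (𝒢 := 𝒢)) := fun p q i c x y => by
  by_cases h : p = [] ∧ q = []
  · obtain ⟨rfl, rfl⟩ := h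
    simp [idForm]
  · have h' : ∀ a : Σ i, 𝒢 i, (p ++ a :: q).length ≠ 1 := fun a ha => h (by
      simp at ha; exact ⟨List.length_eq_zero_iff.mp (by omega),
        List.length_eq_zero_iff.mp (by omega)⟩)
    rw [idForm_arity _ (h' _), idForm_arity _ (h' _), idForm_arity _ (h' _), smul_zero, add_zero]

/-- Unshuffles with empty first sublist. -/
lemma shuffleSum_nil_left (z : List (Σ i, 𝒢 i)) (Φ : List (Σ i, 𝒢 i) → V) :
    (shuffleSum z fun S R => if S = [] then Φ R else 0) = Φ z := by
  induction z generalizing Φ with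
  | nil => rfl
  | cons a z ih =>
    simp only [shuffleSum]
    rw [← ih fun R => Φ (a :: R)]
    refine shuffleSum_congr fun S R _ => ?_
    by_cases h : S = [] <;> simp [h]

variable [DirectSum.Decomposition 𝒢]

lemma listInsert_idForm {K : List (Σ i, 𝒢 i) → V} (hK : ListHom δ K) :
    listInsert δ K idForm = K := by
  ext z
  rw [listInsert, shuffleSum_comm, ← shuffleSum_nil_left z K]
  refine shuffleSum_congr fun S R _ => ?_
  rcases S with _ | ⟨a, S⟩
  · simp [idForm, prj, DirectSum.decompose_of_mem_same 𝒢 (hK R)]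
  · simp [idForm]

lemma listInsert_smul_left {K L : List (Σ i, 𝒢 i) → V} (hL : ListLinear L) (c : ℝ) :
    listInsert δ (c • K) L = c • listInsert δ K L := by
  ext z
  rw [Pi.smul_apply, listInsert, listInsert, ← shuffleSum_smul]
  refine shuffleSum_congr fun S R _ => ?_
  have := hL.map_smul [] R _ c (prj 𝒢 (listDeg S + δ) (K S))
  simp only [List.nil_append] at this
  rw [← this]
  congr 3
  simp only [prj, Pi.smul_apply, DirectSum.decompose_smul]
  rfl

lemma listInsert_smul_right {K L : List (Σ i, 𝒢 i) → V} (c : ℝ) :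
    listInsert δ K (c • L) = c • listInsert δ K L := by
  ext z
  exact shuffleSum_smul z _ c

lemma rnBracketM_listForm_zero (hF : ListLinear F) :
    rnBracketM 𝒢 0 1 (listForm 𝒢 F) (listForm 𝒢 0) = listForm 𝒢 0 := by
  rw [rnBracketM_listForm]
  congr 1
  ext z
  have h₁ : listInsert 0 F (0 : List (Σ i, 𝒢 i) → V) = 0 := by
    simpa using listInsert_smul_right (δ := 0) (K := F) (L := F) 0
  have h₂ : listInsert 1 (0 : List (Σ i, 𝒢 i) → V) F = 0 := by
    simpa using listInsert_smul_left (δ := 1) (K := F) hF 0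
  simp [h₁, h₂]

/-- Insertion is a derivation of convolution products. -/
lemma listInsert_conv (K : List (Σ i, 𝒢 i) → V) :
    listInsert δ K (conv δ' B F G) =
      degSign (δ * δ') • conv δ' B (listInsert δ K F) G +
        conv (δ' + δ) B F (listInsert δ K G) := by
  ext z
  have h₁ : (degSign (δ * δ') • conv δ' B (listInsert δ K F) G) z =
      shuffleSum z fun P S => shuffleSum S fun Q R =>
        degSign (δ' * (listDeg P + δ + listDeg Q)) •
          B (F (⟨listDeg P + δ, prj 𝒢 (listDeg P + δ) (K P)⟩ :: Q)) (G R) := by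
    rw [Pi.smul_apply, ← shuffleSum_assoc z fun P Q R =>
      degSign (δ' * (listDeg P + δ + listDeg Q)) •
        B (F (⟨listDeg P + δ, prj 𝒢 (listDeg P + δ) (K P)⟩ :: Q)) (G R), conv, ← shuffleSum_zsmul]
    refine shuffleSum_congr fun S R _ => ?_
    rw [listInsert, ← LinearMap.flip_apply, ← shuffleSum_linearMap S _ (B.flip (G R)),
      ← shuffleSum_zsmul, ← shuffleSum_zsmul]
    refine shuffleSum_congr fun P Q hS => ?_
    simp only [LinearMap.flip_apply, smul_smul, ← degSign_add,
      ← hS.listDeg_eq, listDeg_append]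
    ring_nf
  have h₂ : conv (δ' + δ) B F (listInsert δ K G) z =
      shuffleSum z fun P S => shuffleSum S fun Q R =>
        degSign ((listDeg P + δ + δ') * listDeg Q) •
          B (F Q) (G (⟨listDeg P + δ, prj 𝒢 (listDeg P + δ) (K P)⟩ :: R)) := by
    rw [shuffleSum_comm₁₂]
    refine shuffleSum_congr fun P S _ => ?_
    rw [listInsert, ← shuffleSum_linearMap S _ (B (F P)), ← shuffleSum_zsmul]
    refine shuffleSum_congr fun Q R _ => ?_
    simp only [smul_smul, ← degSign_add]
    congr 1
    refine degSign_congr ?_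
    simp only [Int.even_add, Int.even_mul]
    tauto
  rw [Pi.add_apply, h₁, h₂, ← shuffleSum_add]
  refine shuffleSum_congr fun P S _ => ?_
  rw [← shuffleSum_add, conv, shuffleSum]
  refine shuffleSum_congr fun Q R _ => ?_
  rw [listDeg_cons, smul_smul, ← degSign_add, add_mul (listDeg P + δ)]

end Convolution

/-! ### Convolution powers in a Gerstenhaber algebra -/

section GerstenhaberConv

variable {V : Type*} [AddCommGroup V] [Module ℝ V] {𝒜 : ℤ → Submodule ℝ V} (G : Gerstenhaber 𝒜)
  {α β δ : ℤ} {F H K : List (Σ i, negG 𝒜 i) → V}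

/-- Convolution product, for the product of `G`, with the identity. -/
def mulId : Module.End ℝ (List (Σ i, negG 𝒜 i) → V) where
  toFun F := conv 0 G.wedge F idForm
  map_add' _ _ := conv_add_left
  map_smul' c _ := conv_smul_left c

/-- Convolution product of the identity with itself, for the bracket of `G`. -/
def idBracket : List (Σ i, negG 𝒜 i) → V := conv 1 G.bracket idForm idForm

lemma mulId_apply : mulId G F = conv 0 G.wedge F idForm := rfl

lemma negG_wedge_mem (i j : ℤ) (x y : V) (hx : x ∈ negG 𝒜 i) (hy : y ∈ negG 𝒜 j) :
    G.wedge x y ∈ negG 𝒜 (i + j + 0) := by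
  have := G.wedge_mem _ _ _ _ hx hy
  rwa [show -i + -j = -(i + j + 0) by ring] at this

lemma negG_bracket_mem (i j : ℤ) (x y : V) (hx : x ∈ negG 𝒜 i) (hy : y ∈ negG 𝒜 j) :
    G.bracket x y ∈ negG 𝒜 (i + j + 1) := by
  have := G.bracket_mem _ _ _ _ hx hy
  rwa [show -i + -j - 1 = -(i + j + 1) by ring] at this

lemma mulId_pow_hom (hF : ListHom α F) (p : ℕ) : ListHom α ((mulId G ^ p) F) := by
  induction p with
  | zero => exact hF
  | succ p ih =>
    rw [pow_succ', Module.End.mul_apply]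
    simpa [mulId_apply] using ListHom.conv (δ := 0) ih idForm_hom (negG_wedge_mem G)

lemma mulId_pow_symm (hF : ListSymm F) (p : ℕ) : ListSymm ((mulId G ^ p) F) := by
  induction p with
  | zero => exact hF
  | succ p ih =>
    rw [pow_succ', Module.End.mul_apply]
    exact ih.conv idForm_symm

lemma mulId_pow_linear (hF : ListLinear F) (p : ℕ) : ListLinear ((mulId G ^ p) F) := by
  induction p with
  | zero => exact hF
  | succ p ih =>
    rw [pow_succ', Module.End.mul_apply]
    exact ih.conv idForm_linear

lemma mulId_pow_arity {k : ℕ} (hF : ListArity k F) (p : ℕ) :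
    ListArity (k + p) ((mulId G ^ p) F) := by
  induction p with
  | zero => exact hF
  | succ p ih =>
    rw [pow_succ', Module.End.mul_apply]
    exact ih.conv idForm_arity

lemma idBracket_hom : ListHom 1 (idBracket G) := by
  simpa [idBracket] using ListHom.conv (δ := 1) idForm_hom idForm_hom (negG_bracket_mem G)

lemma idBracket_symm : ListSymm (idBracket G) := idForm_symm.conv idForm_symm

lemma idBracket_linear : ListLinear (idBracket G) := idForm_linear.conv idForm_linear

lemma idBracket_arity : ListArity 2 (idBracket G) := idForm_arity.conv idForm_arity

lemma conv_wedge_comm (hF : ListHom α F) (hH : ListHom β H) :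
    conv β G.wedge F H = degSign (α * β) • conv α G.wedge H F := by
  ext z
  rw [conv, shuffleSum_comm, Pi.smul_apply, conv, ← shuffleSum_zsmul]
  refine shuffleSum_congr fun S R _ => ?_
  rw [G.wedge_comm _ _ _ _ (hF R) (hH S), ← degSign, smul_smul, smul_smul, smul_smul,
    ← degSign_add, ← degSign_add, ← degSign_add]
  congr 1
  refine degSign_congr ?_
  simp only [Int.even_add, Int.even_mul, even_neg]
  tauto

lemma conv_bracket_antisymm (hF : ListHom α F) (hH : ListHom β H) :
    conv (β + 1) G.bracket F H =
      -degSign ((α + 1) * (β + 1)) • conv (α + 1) G.bracket H F := by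
  ext z
  rw [conv, shuffleSum_comm, Pi.smul_apply, conv, ← shuffleSum_zsmul]
  refine shuffleSum_congr fun S R _ => ?_
  rw [G.bracket_antisymm _ _ _ _ (hF R) (hH S), ← degSign, smul_neg, smul_neg, neg_smul, smul_smul,
    smul_smul, smul_smul, ← degSign_add, ← degSign_add, ← degSign_add]
  congr 2
  refine degSign_congr ?_
  simp only [Int.even_add, Int.even_sub, Int.even_mul, even_neg, Int.not_even_one]
  by_cases Even α <;> by_cases Even β <;> by_cases Even (listDeg S) <;>
    by_cases Even (listDeg R) <;> simp [*]

lemma conv_bracket_id_wedge (hF : ListHom α F) :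
    conv δ G.bracket idForm (conv 0 G.wedge F H) =
      conv 0 G.wedge (conv δ G.bracket idForm F) H +
        degSign α • conv 1 G.wedge F (conv (δ + α) G.bracket idForm H) := by
  ext z
  rw [Pi.add_apply, Pi.smul_apply, conv_conv_right, conv_conv_left, conv_conv_right,
    shuffleSum_comm₁₂ z fun P Q R => degSign (1 * listDeg P + (δ + α) * listDeg Q) •
      G.wedge (F P) (G.bracket (idForm Q) (H R)), ← shuffleSum_zsmul, ← shuffleSum_add]
  refine shuffleSum_congr fun P S _ => ?_
  rw [← shuffleSum_zsmul, ← shuffleSum_add]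
  refine shuffleSum_congr fun Q R _ => ?_
  rw [G.leibniz _ _ _ _ _ (idForm_hom P) (hF Q), ← degSign, smul_add, smul_smul, smul_smul,
    smul_smul, ← degSign_add, ← degSign_add, ← degSign_add]
  congr 2
  · ring_nf
  · refine degSign_congr ?_
    simp only [Int.even_add, Int.even_sub, Int.even_mul, even_neg, Int.not_even_one]
    by_cases Even α <;> by_cases Even (listDeg P) <;> by_cases Even (listDeg Q) <;> simp [*]

lemma conv_bracket_id_left (hF : ListHom α F) :
    conv (α + 1) G.bracket idForm F = degSign α • conv 1 G.bracket F idForm := by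
  rw [conv_bracket_antisymm G idForm_hom hF]
  simp [degSign_add]

lemma conv_bracket_mulId (hF : ListHom α F) :
    conv 1 G.bracket (mulId G F) idForm =
      mulId G (conv 1 G.bracket F idForm) + conv 1 G.wedge F (idBracket G) := by
  have h := conv_bracket_id_wedge G (δ := α + 1) (H := idForm) hF
  have hM : ListHom α (mulId G F) := by simpa using mulId_pow_hom G hF 1
  rw [← mulId_apply, conv_bracket_id_left G hM, conv_bracket_id_left G hF,
    conv_congr (δ := α + 1 + α) (δ' := 1), ← mulId_apply, map_zsmul, ← smul_add] at h
  · have := congrArg (degSign α • ·) h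
    simpa only [smul_smul, degSign_mul_self, one_smul, idBracket] using this
  · simp only [Int.even_add, Int.not_even_one]
    tauto

lemma conv_bracket_idBracket : conv 1 G.bracket (idBracket G) idForm = 0 := by
  have h₁ : conv 0 G.bracket idForm (idBracket G) =
      -conv 1 G.bracket (idBracket G) idForm := by
    have := conv_bracket_id_left G (idBracket_hom G)
    rw [conv_congr (δ' := 0) (by decide)] at this
    simpa using this
  have h₂ : conv 0 G.bracket idForm (idBracket G) + conv 0 G.bracket idForm (idBracket G) =
      conv 1 G.bracket (idBracket G) idForm := by
    ext z
    rw [Pi.add_apply, idBracket, conv_conv_left, conv_conv_right]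
    conv_lhs =>
      enter [1]
      rw [shuffleSum_comm₁₂]
    rw [← shuffleSum_add]
    refine shuffleSum_congr fun P S _ => ?_
    rw [← shuffleSum_add]
    refine shuffleSum_congr fun Q R _ => ?_
    rw [G.jacobi _ _ (idForm P) (idForm Q) _ (idForm_hom P) (idForm_hom Q), ← degSign, smul_add,
      smul_smul, smul_smul, ← degSign_add, ← degSign_add]
    have s₁ : degSign (listDeg P * listDeg Q + (0 * listDeg Q + 1 * listDeg P)) =
        -degSign (0 * listDeg P + 1 * listDeg Q +
          (-(listDeg P + 0) - 1) * (-(listDeg Q + 0) - 1)) := by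
      rw [← neg_one_mul, ← degSign_one, ← degSign_add]
      refine degSign_congr ?_
      simp only [Int.even_add, Int.even_sub, Int.even_mul, even_neg, Int.not_even_one]
      by_cases Even (listDeg P) <;> by_cases Even (listDeg Q) <;> simp [*]
    have s₂ : degSign (1 * listDeg P + 1 * listDeg Q + 1 * listDeg P) =
        degSign (0 * listDeg P + 1 * listDeg Q) := by
      refine degSign_congr ?_
      simp only [Int.even_add, Int.even_mul, Int.not_even_one]
      tauto
    rw [s₁, s₂, neg_smul]
    abel
  rw [h₁, ← neg_add, neg_eq_iff_add_eq_zero] at h₂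
  have h₃ : (3 : ℝ) • conv 1 G.bracket (idBracket G) idForm = 0 := by
    rw [← h₂]
    module
  exact (smul_eq_zero.mp h₃).resolve_left (by norm_num)

lemma conv_mulId_pow (p : ℕ) :
    conv δ G.wedge F ((mulId G ^ p) H) = (mulId G ^ p) (conv δ G.wedge F H) := by
  induction p with
  | zero => rfl
  | succ p ih =>
    rw [pow_succ', Module.End.mul_apply, Module.End.mul_apply, ← ih]
    exact conv_assoc fun x y z => G.wedge_assoc x y z

lemma conv_mulId_pow_idForm (p : ℕ) :
    conv 0 G.wedge F ((mulId G ^ p) idForm) = (mulId G ^ (p + 1)) F := by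
  rw [conv_mulId_pow, pow_succ, Module.End.mul_apply, mulId_apply]

lemma conv_mulId_pow_idForm_left (hK : ListHom δ K) (p : ℕ) :
    conv δ G.wedge ((mulId G ^ p) idForm) K = (mulId G ^ (p + 1)) K := by
  rw [conv_wedge_comm G (mulId_pow_hom G idForm_hom p) hK, conv_mulId_pow_idForm]
  simp

lemma conv_mulId_pow_idBracket (i j : ℕ) :
    conv 1 G.wedge ((mulId G ^ i) (idBracket G)) ((mulId G ^ j) (idBracket G)) = 0 := by
  have hanti : ∀ i j : ℕ, conv 1 G.wedge ((mulId G ^ i) (idBracket G))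
      ((mulId G ^ j) (idBracket G)) = -conv 1 G.wedge ((mulId G ^ j) (idBracket G))
        ((mulId G ^ i) (idBracket G)) := fun i j => by
    rw [conv_wedge_comm G (mulId_pow_hom G (idBracket_hom G) i)
      (mulId_pow_hom G (idBracket_hom G) j)]
    simp
  have h₀ : conv 1 G.wedge (idBracket G) (idBracket G) = 0 := by
    have h₂ : (2 : ℝ) • conv 1 G.wedge (idBracket G) (idBracket G) = 0 := by
      rw [two_smul]
      exact eq_neg_iff_add_eq_zero.mp (hanti 0 0)
    exact (smul_eq_zero.mp h₂).resolve_left two_ne_zero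
  have h₁ := hanti i 0
  rw [pow_zero, Module.End.one_apply, conv_mulId_pow, h₀, map_zero, neg_zero] at h₁
  rw [conv_mulId_pow, h₁, map_zero]

lemma conv_bracket_mulId_pow_idForm (p : ℕ) :
    conv 1 G.bracket ((mulId G ^ p) idForm) idForm =
      ((p : ℝ) + 1) • (mulId G ^ p) (idBracket G) := by
  induction p with
  | zero =>
    simp [idBracket]
  | succ p ih =>
    rw [pow_succ', Module.End.mul_apply, conv_bracket_mulId G (mulId_pow_hom G idForm_hom p), ih,
      conv_mulId_pow_idForm_left G (idBracket_hom G), map_smul, pow_succ', Module.End.mul_apply]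
    push_cast
    module

lemma conv_bracket_mulId_pow_idBracket (p : ℕ) :
    conv 1 G.bracket ((mulId G ^ p) (idBracket G)) idForm = 0 := by
  induction p with
  | zero => exact conv_bracket_idBracket G
  | succ p ih =>
    have h := conv_mulId_pow_idBracket G p 0
    rw [pow_zero, Module.End.one_apply] at h
    rw [pow_succ', Module.End.mul_apply,
      conv_bracket_mulId G (mulId_pow_hom G (idBracket_hom G) p), ih, map_zero, h, zero_add]

variable [DirectSum.Decomposition (negG 𝒜)]

lemma listInsert_mulId (hK : ListHom δ K) :
    listInsert δ K (mulId G F) = mulId G (listInsert δ K F) + conv δ G.wedge F K := by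
  rw [mulId_apply, listInsert_conv, listInsert_idForm hK, zero_add, mul_zero, degSign_zero,
    one_smul, mulId_apply]

lemma listInsert_mulId_pow_idForm (hK : ListHom δ K) (p : ℕ) :
    listInsert δ K ((mulId G ^ p) idForm) = ((p : ℝ) + 1) • (mulId G ^ p) K := by
  induction p with
  | zero => simp [listInsert_idForm hK]
  | succ p ih =>
    rw [pow_succ', Module.End.mul_apply, listInsert_mulId G hK, ih,
      conv_mulId_pow_idForm_left G hK, map_smul, pow_succ', Module.End.mul_apply]
    push_cast
    module

lemma listInsert_idBracket (hK : ListHom δ K) :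
    listInsert δ K (idBracket G) = (2 * degSign δ) • conv 1 G.bracket K idForm := by
  rw [idBracket, listInsert_conv, listInsert_idForm hK, add_comm 1 δ, conv_bracket_id_left G hK,
    mul_one, two_mul, add_smul]

lemma listInsert_mulId_pow_idBracket (p j : ℕ) :
    listInsert 0 ((mulId G ^ p) idForm) ((mulId G ^ j) (idBracket G)) =
      (2 * ((p : ℝ) + 1) + j) • (mulId G ^ (j + p)) (idBracket G) := by
  have hX := mulId_pow_hom G idForm_hom p
  induction j with
  | zero =>
    rw [pow_zero, Module.End.one_apply, listInsert_idBracket G hX,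
      conv_bracket_mulId_pow_idForm, zero_add]
    simp
    module
  | succ j ih =>
    rw [pow_succ', Module.End.mul_apply, listInsert_mulId G hX, ih, conv_mulId_pow_idForm,
      map_smul, ← Module.End.mul_apply, ← Module.End.mul_apply, ← pow_succ', ← pow_add,
      show p + 1 + j = j + 1 + p by ring, show j + p + 1 = j + 1 + p by ring]
    push_cast
    module

lemma listInsert_idBracket_mulId_pow_idBracket (p j : ℕ) :
    listInsert 1 ((mulId G ^ p) (idBracket G)) ((mulId G ^ j) (idBracket G)) = 0 := by
  have hQ := mulId_pow_hom G (idBracket_hom G) p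
  induction j with
  | zero =>
    rw [pow_zero, Module.End.one_apply, listInsert_idBracket G hQ,
      conv_bracket_mulId_pow_idBracket, smul_zero]
  | succ j ih =>
    rw [pow_succ', Module.End.mul_apply, listInsert_mulId G hQ, ih, map_zero,
      conv_mulId_pow_idBracket, zero_add]

end GerstenhaberConv

/-! ### The forms `mathcalN` and `lFormsG` as functions of lists -/

section Identification

variable {V : Type*} [AddCommGroup V] [Module ℝ V] {𝒜 : ℤ → Submodule ℝ V} (G : Gerstenhaber 𝒜)

/-- Iterated product of the elements of a nonempty list. -/
def wedgeList : List (Σ i, negG 𝒜 i) → V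
  | [] => 0
  | [a] => a.2
  | a :: b :: z => G.wedge a.2 (wedgeList (b :: z))

lemma wedgeList_cons (a : Σ i, negG 𝒜 i) {z : List (Σ i, negG 𝒜 i)} (hz : z ≠ []) :
    wedgeList G (a :: z) = G.wedge a.2 (wedgeList G z) := by
  cases z with
  | nil => exact absurd rfl hz
  | cons b z => rfl

lemma wedgeList_ofFn {k : ℕ} (z : Fin (k + 1) → Σ i, negG 𝒜 i) :
    wedgeList G (List.ofFn z) = wedgeAll G fun i => ((z i).2 : V) := by
  induction k with
  | zero => simp [wedgeList, wedgeAll]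
  | succ k ih =>
    rw [List.ofFn_succ, wedgeList_cons G _ (by simp), ih]
    rfl

lemma conv_idForm_wedgeList (z : List (Σ i, negG 𝒜 i)) (hz : 2 ≤ z.length) :
    conv 0 G.wedge idForm (wedgeList G) z = (z.length : ℝ) • wedgeList G z := by
  induction z with
  | nil => simp at hz
  | cons a z ih =>
    have hz' : z ≠ [] := by
      rintro rfl
      simp at hz
    have h₁ : (shuffleSum z fun S R => G.wedge (idForm (a :: S)) (wedgeList G R)) =
        wedgeList G (a :: z) := by
      rw [wedgeList_cons G a hz', ← shuffleSum_nil_left z fun R => G.wedge a.2 (wedgeList G R)]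
      refine shuffleSum_congr fun S R _ => ?_
      cases S <;> simp [idForm]
    have hcomm : ∀ (S : List (Σ i, negG 𝒜 i)) (v : V), degSign (a.1 * listDeg S) •
        G.wedge (idForm S) (G.wedge a.2 v) = G.wedge a.2 (G.wedge (idForm S) v) := fun S v => by
      rw [← G.wedge_assoc, ← G.wedge_assoc, G.wedge_comm _ _ _ _ a.2.2 (idForm_hom S), ← degSign,
        map_zsmul, LinearMap.smul_apply]
      congr 1
      refine degSign_congr ?_
      simp only [Int.even_mul, even_neg, add_zero]
    have h₂ : (shuffleSum z fun S R => degSign (a.1 * listDeg S) •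
        G.wedge (idForm S) (wedgeList G (a :: R))) = (z.length : ℝ) • wedgeList G (a :: z) := by
      obtain _ | ⟨b, _ | ⟨c, y⟩⟩ := z
      · exact absurd rfl hz'
      · have := G.wedge_comm _ _ _ _ a.2.2 b.2.2
        rw [← degSign] at this
        simp [shuffleSum, idForm, wedgeList, this]
      · rw [wedgeList_cons G a hz', ← map_smul, ← ih (by simp),
          conv, ← shuffleSum_linearMap]
        refine shuffleSum_congr fun S R hp => ?_
        by_cases hS : S.length = 1
        · have hR : R ≠ [] := by
            rintro rfl
            have := hp.length_eq
            simp at this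
            omega
          rw [wedgeList_cons G a hR, hcomm, zero_mul, degSign_zero, one_smul]
        · simp [idForm_arity S hS]
    simp only [conv, zero_mul, degSign_zero, one_smul, shuffleSum, shuffleSum_add, h₁, h₂,
      List.length_cons]
    push_cast
    module

lemma mulId_pow_idForm_apply {p : ℕ} {z : List (Σ i, negG 𝒜 i)} (hz : z.length = p + 1) :
    (mulId G ^ p) idForm z = ((p + 1).factorial : ℝ) • wedgeList G z := by
  induction p generalizing z with
  | zero =>
    obtain ⟨a, rfl⟩ := List.length_eq_one_iff.mp hz
    simp [idForm, wedgeList]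
  | succ p ih =>
    rw [← conv_mulId_pow_idForm]
    have h : conv 0 G.wedge idForm ((mulId G ^ p) idForm) z =
        ((p + 1).factorial : ℝ) • conv 0 G.wedge idForm (wedgeList G) z := by
      rw [conv, conv, ← shuffleSum_smul]
      refine shuffleSum_congr fun S R hp => ?_
      by_cases hS : S.length = 1
      · have := hp.length_eq
        rw [List.length_append] at this
        rw [ih (by omega), map_smul, smul_comm]
      · simp [idForm_arity S hS]
    rw [h, conv_idForm_wedgeList G z (by omega), smul_smul, hz, Nat.factorial_succ (p + 1),
      mul_comm]
    push_cast
    rfl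

lemma mathcalN_eq_listForm (p : ℕ) : mathcalN G (negG 𝒜) (p + 1) =
    listForm (negG 𝒜) ((((p + 1).factorial : ℝ)⁻¹) • (mulId G ^ p) idForm) (p + 1) := by
  ext d x
  rw [listForm, Pi.smul_apply, mulId_pow_idForm_apply G (by simp), smul_smul,
    inv_mul_cancel₀ (by positivity), one_smul, wedgeList_ofFn]
  rfl

lemma idBracket_pair (a b : Σ i, negG 𝒜 i) :
    idBracket G [a, b] = (2 : ℝ) • degSign a.1 • G.bracket a.2 b.2 := by
  have hb := G.bracket_antisymm _ _ _ _ b.2.2 a.2.2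
  have hs : degSign (a.1 * b.1 + b.1 + (-b.1 - 1) * (-a.1 - 1)) = degSign (1 + a.1) := by
    refine degSign_congr ?_
    simp only [Int.even_add, Int.even_sub, Int.even_mul, even_neg, Int.not_even_one]
    by_cases Even a.1 <;> by_cases Even b.1 <;> simp [*]
  simp only [degSign_add, degSign_one, neg_one_mul, mul_assoc] at hs
  rw [← degSign] at hb
  simp [idBracket, conv, shuffleSum, idForm, hb, smul_smul, hs, two_smul]

lemma l2G_eq_listForm : l2G G (negG 𝒜) = listForm (negG 𝒜) ((2 : ℝ)⁻¹ • idBracket G) 2 := by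
  ext d x
  change _ = (2 : ℝ)⁻¹ • idBracket G [⟨d 0, x 0⟩, ⟨d 1, x 1⟩]
  rw [idBracket_pair, smul_smul, inv_mul_cancel₀ two_ne_zero, one_smul]
  rfl

variable {𝒢 : ℤ → Submodule ℝ V}

lemma singleF_eq_listForm {F : List (Σ i, 𝒢 i) → V} {k : ℕ} {K : GForm 𝒢 k}
    (hK : K = listForm 𝒢 F k) (hF : ListArity k F) : singleF 𝒢 k K = listForm 𝒢 F := by
  subst hK
  ext n d x
  by_cases h : n = k
  · subst h
    simp [singleF, castForm]
  · rw [singleF, dif_neg h, listForm, hF _ (by simpa using h)]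
    rfl

lemma singleF_mathcalN (p : ℕ) : singleF (negG 𝒜) (p + 1) (mathcalN G (negG 𝒜) (p + 1)) =
    listForm (negG 𝒜) ((((p + 1).factorial : ℝ)⁻¹) • (mulId G ^ p) idForm) :=
  singleF_eq_listForm (mathcalN_eq_listForm G p)
    (by simpa [add_comm] using (mulId_pow_arity G idForm_arity p).smul _)

lemma isSymFormOfDeg_mulId_pow (c : ℝ) (p k : ℕ) :
    IsSymFormOfDeg (negG 𝒜) 0 (listForm (negG 𝒜) (c • (mulId G ^ p) idForm) k) :=
  isSymFormOfDeg_listForm ((mulId_pow_hom G idForm_hom p).smul c)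
    ((mulId_pow_linear G idForm_linear p).smul c) ((mulId_pow_symm G idForm_symm p).smul c) k

variable [DirectSum.Decomposition (negG 𝒜)]

lemma lFormsG_eq_listForm (n : ℕ) : lFormsG G (negG 𝒜) (n + 2) =
    listForm (negG 𝒜) ((2 * (n.factorial : ℝ))⁻¹ • (mulId G ^ n) (idBracket G)) (n + 2) := by
  obtain _ | i := n
  · simpa [lFormsG] using l2G_eq_listForm G
  · ext d x
    rw [lFormsG, l2G_eq_listForm, mathcalN_eq_listForm, castForm_insertionOp_listForm]
    have hL := (mulId_pow_linear G (idForm_linear (𝒢 := negG 𝒜)) (i + 1)).smul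
      (((i + 1 + 1).factorial : ℝ)⁻¹)
    have hQ := idBracket_hom G
    trans listInsert 1 ((2 : ℝ)⁻¹ • idBracket G)
      (((i + 1 + 1).factorial : ℝ)⁻¹ • (mulId G ^ (i + 1)) idForm) (List.ofFn fun i => ⟨d i, x i⟩)
    · refine shuffleSum_congr fun S R _ => ?_
      split_ifs with h
      · rfl
      · rw [(idBracket_arity G).smul _ S h]
        have := hL.map_zero [] R (listDeg S + 1)
        simpa [prj] using this.symm
    · rw [listInsert_smul_left hL, listInsert_smul_right, listInsert_mulId_pow_idForm G hQ,
        smul_smul, smul_smul, listForm, Nat.factorial_succ (i + 1)]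
      push_cast
      field_simp

lemma singleF_lFormsG (n : ℕ) : singleF (negG 𝒜) (n + 2) (lFormsG G (negG 𝒜) (n + 2)) =
    listForm (negG 𝒜) ((2 * (n.factorial : ℝ))⁻¹ • (mulId G ^ n) (idBracket G)) :=
  singleF_eq_listForm (lFormsG_eq_listForm G n)
    (by simpa [add_comm] using (mulId_pow_arity G (idBracket_arity G) n).smul _)

lemma singleF_lFormsG_one :
    singleF (negG 𝒜) 1 (lFormsG G (negG 𝒜) 1) = listForm (negG 𝒜) 0 :=
  singleF_eq_listForm rfl fun _ _ => rfl

lemma rnBracketM_mulId_pow (p n : ℕ) (c e : ℝ) :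
    rnBracketM (negG 𝒜) 0 1 (listForm (negG 𝒜) (c • (mulId G ^ p) idForm))
      (listForm (negG 𝒜) (e • (mulId G ^ n) (idBracket G))) =
    listForm (negG 𝒜) ((c * e * (p + 1 + n)) • (mulId G ^ (n + p)) (idBracket G)) := by
  rw [rnBracketM_listForm]
  congr 1
  ext z
  have hX := mulId_pow_linear G (idForm_linear (𝒢 := negG 𝒜)) p
  have hQ := mulId_pow_linear G (idBracket_linear G) n
  have hQ' := mulId_pow_hom G (idBracket_hom G) n
  rw [listInsert_smul_left (hQ.smul e), listInsert_smul_right, listInsert_mulId_pow_idBracket,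
    listInsert_smul_left (hX.smul c), listInsert_smul_right, listInsert_mulId_pow_idForm G hQ',
    ← Module.End.mul_apply, ← pow_add, add_comm p n, zero_mul, degSign_zero, one_smul]
  simp only [Pi.smul_apply]
  module

lemma isSymFormOfDeg_lFormsG {n : ℕ} (hn : 1 ≤ n) :
    IsSymFormOfDeg (negG 𝒜) 1 (lFormsG G (negG 𝒜) n) := by
  obtain rfl | ⟨q, rfl⟩ : n = 1 ∨ ∃ q, n = q + 2 := by
    rcases n with _ | _ | q <;> simp at hn ⊢
  · exact ⟨fun _ _ => zero_mem _, fun _ _ _ _ _ => (add_zero _).symm,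
      fun _ _ _ _ _ => (smul_zero _).symm, fun _ _ _ => (smul_zero _).symm⟩
  · rw [lFormsG_eq_listForm]
    exact isSymFormOfDeg_listForm ((mulId_pow_hom G (idBracket_hom G) q).smul _)
      ((mulId_pow_linear G (idBracket_linear G) q).smul _)
      ((mulId_pow_symm G (idBracket_symm G) q).smul _) _

lemma rnBracketM_lFormsG_self {n : ℕ} (hn : 1 ≤ n) :
    rnBracketM (negG 𝒜) 1 1 (singleF (negG 𝒜) n (lFormsG G (negG 𝒜) n))
      (singleF (negG 𝒜) n (lFormsG G (negG 𝒜) n)) = 0 := by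
  obtain rfl | ⟨q, rfl⟩ : n = 1 ∨ ∃ q, n = q + 2 := by
    rcases n with _ | _ | q <;> simp at hn ⊢
  · rw [singleF_lFormsG_one, rnBracketM_listForm]
    ext k d x
    simp [listForm, listInsert]
  · rw [singleF_lFormsG, rnBracketM_listForm, listInsert_smul_left
      ((mulId_pow_linear G (idBracket_linear G) q).smul _), listInsert_smul_right,
      listInsert_idBracket_mulId_pow_idBracket]
    ext k d x
    simp [listForm]

end Identification

/-- For any `n ≥ 1`, `l_n` is an `L_∞`-structure on `E` and for all
`m, n ≥ 1`, `𝒩_m` is co-boundary Nijenhuis with respect to `l_n` and, up to a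
multiplicative constant, `l_{n+m-1}` is the deformed structure `[𝒩_m, l_n]_RN`. -/
theorem mathcalN_coboundary_nijenhuis
    {V : Type*} [AddCommGroup V] [Module ℝ V] {𝒜 : ℤ → Submodule ℝ V}
    (G : Gerstenhaber 𝒜) [DirectSum.Decomposition (negG 𝒜)]
    (m n : ℕ) (hm : 1 ≤ m) (hn : 1 ≤ n) :
    (IsSymFormOfDeg (negG 𝒜) 1 (lFormsG G (negG 𝒜) n) ∧
      rnBracketM (negG 𝒜) 1 1 (singleF (negG 𝒜) n (lFormsG G (negG 𝒜) n))
        (singleF (negG 𝒜) n (lFormsG G (negG 𝒜) n)) = 0) ∧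
    (∃ Ksq : MultiForm (negG 𝒜), (∀ k : ℕ, IsSymFormOfDeg (negG 𝒜) 0 (Ksq k)) ∧
      rnBracketM (negG 𝒜) 0 1 (singleF (negG 𝒜) m (mathcalN G (negG 𝒜) m))
          (rnBracketM (negG 𝒜) 0 1 (singleF (negG 𝒜) m (mathcalN G (negG 𝒜) m))
            (singleF (negG 𝒜) n (lFormsG G (negG 𝒜) n)))
        = rnBracketM (negG 𝒜) 0 1 Ksq (singleF (negG 𝒜) n (lFormsG G (negG 𝒜) n))) ∧
    (∃ c : ℝ,
      rnBracketM (negG 𝒜) 0 1 (singleF (negG 𝒜) m (mathcalN G (negG 𝒜) m))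
          (singleF (negG 𝒜) n (lFormsG G (negG 𝒜) n))
        = c • singleF (negG 𝒜) (m + n - 1) (lFormsG G (negG 𝒜) (m + n - 1))) := by
  obtain ⟨p, rfl⟩ : ∃ p, m = p + 1 := ⟨m - 1, by omega⟩
  refine ⟨⟨isSymFormOfDeg_lFormsG G hn, rnBracketM_lFormsG_self G hn⟩, ?_⟩
  obtain rfl | ⟨q, rfl⟩ : n = 1 ∨ ∃ q, n = q + 2 := by
    rcases n with _ | _ | q <;> simp at hn ⊢
  · have hzero : listForm (negG 𝒜) (0 : List (Σ i, negG 𝒜 i) → V) = 0 := rfl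
    have hlin (c : ℝ) (k : ℕ) := (mulId_pow_linear G (idForm_linear (𝒢 := negG 𝒜)) k).smul c
    rw [singleF_mathcalN, singleF_lFormsG_one, rnBracketM_listForm_zero (hlin _ _),
      rnBracketM_listForm_zero (hlin _ _)]
    exact ⟨⟨_, isSymFormOfDeg_mulId_pow G 0 p,
      (rnBracketM_listForm_zero (hlin _ _)).symm⟩, 0, by rw [zero_smul, hzero]⟩
  · rw [show p + 1 + (q + 2) - 1 = q + p + 2 by omega]
    simp only [singleF_mathcalN, singleF_lFormsG, rnBracketM_mulId_pow]
    refine ⟨⟨_, isSymFormOfDeg_mulId_pow G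
      (((p + 1).factorial : ℝ)⁻¹ * ((p + 1).factorial : ℝ)⁻¹ * (p + 1 + q)) (p + p), ?_⟩,
      ((p + 1).factorial : ℝ)⁻¹ * (2 * (q.factorial : ℝ))⁻¹ * (p + 1 + q) *
        (2 * ((q + p).factorial : ℝ)), ?_⟩
    · rw [rnBracketM_mulId_pow, add_assoc q p p]
      push_cast
      ring_nf
    · have hsmul (c : ℝ) (F : List (Σ i, negG 𝒜 i) → V) :
          c • listForm (negG 𝒜) F = listForm (negG 𝒜) (c • F) := rfl
      rw [hsmul, smul_smul, mul_inv_cancel_right₀ (by positivity)]
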